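/- arXiv:2301.00083 — 5 statements merged into one kernel-verified Lean document; each statement's English description precedes it below -/
import Mathlib

section
/- Let T, β_μ, α_ν, L > 0 and let ᾱ ∈ (α_ν − 1/T, ∞) be a solution of the fixed point equation ᾱ = α_ν − 1/T + G(ᾱ, 2)/(2T²). Then α_ν/2 − 1/T − L/(2T²α_νβ_μ) + (1/2)·√((α_ν + L/(T²β_μα_ν))² + 4α_ν/(T²β_μ)) ≤ ᾱ ≤ α_ν/2 − 1/T + (1/2)·√(α_ν² + 4α_ν/(T²β_μ)). -/
open MeasureTheory Real Filter
open scoped RealInnerProductSpace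

noncomputable section

abbrev Euc (d : ℕ) := EuclideanSpace ℝ (Fin d)

/-- `fL L r = 2 √L · tanh(r √L / 2)`. -/
def fL (L r : ℝ) : ℝ := 2 * Real.sqrt L * Real.tanh (r * Real.sqrt L / 2)

/-- Integrated convexity lower bound `κ_U(r)`. -/
def kappa {d : ℕ} (U : Euc d → ℝ) (r : ℝ) : ℝ :=
  sInf {k : ℝ | ∃ x y : Euc d, ‖x - y‖ = r ∧
    k = (‖x - y‖ ^ 2)⁻¹ * ⟪gradient U x - gradient U y, x - y⟫}

/-- Integrated concavity upper bound `ℓ_U(r)`. -/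
def ell {d : ℕ} (U : Euc d → ℝ) (r : ℝ) : ℝ :=
  sSup {k : ℝ | ∃ x y : Euc d, ‖x - y‖ = r ∧
    k = (‖x - y‖ ^ 2)⁻¹ * ⟪gradient U x - gradient U y, x - y⟫}

/-- `F(α, s)` from the paper (parameters `T, βμ, L`). -/
def Ffun (T βμ L α s : ℝ) : ℝ :=
  βμ * s + s / (T * (1 + T * α)) + Real.sqrt s * fL L (Real.sqrt s) / (1 + T * α) ^ 2

/-- `G(α, u) = inf {s ≥ 0 : F(α, s) ≥ u}`. -/
def Gfun (T βμ L α u : ℝ) : ℝ := sInf {s : ℝ | 0 ≤ s ∧ u ≤ Ffun T βμ L α s}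

theorem aux_tanh {x : ℝ} (hx : 0 ≤ x) : 0 ≤ Real.tanh x ∧ Real.tanh x ≤ x := by
  rw [Real.tanh_eq_sinh_div_cosh]
  refine ⟨div_nonneg (Real.sinh_nonneg_iff.2 hx) (Real.cosh_pos x).le, ?_⟩
  rw [div_le_iff₀ (Real.cosh_pos x)]
  have hmono : MonotoneOn (fun y : ℝ => y * Real.cosh y - Real.sinh y) (Set.Ici 0) := by
    have hd : ∀ y : ℝ, HasDerivAt (fun y : ℝ => y * Real.cosh y - Real.sinh y)
        (y * Real.sinh y) y := by
      intro y
      have := ((hasDerivAt_id y).mul (Real.hasDerivAt_cosh y)).sub (Real.hasDerivAt_sinh y)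
      refine HasDerivAt.congr_deriv this ?_
      simp only [id]
      ring
    apply monotoneOn_of_deriv_nonneg (convex_Ici 0)
    · exact fun y _ => (hd y).continuousAt.continuousWithinAt
    · exact fun y _ => (hd y).differentiableAt.differentiableWithinAt
    · intro y hy
      rw [interior_Ici] at hy
      rw [(hd y).deriv]
      exact mul_nonneg (le_of_lt hy) (Real.sinh_nonneg_iff.2 (le_of_lt hy))
  have := hmono (Set.mem_Ici.2 le_rfl) (Set.mem_Ici.2 hx) hx
  simp at this
  linarith

theorem aux_f {L s : ℝ} (hL : 0 < L) (hs : 0 ≤ s) :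
    0 ≤ Real.sqrt s * fL L (Real.sqrt s) ∧ Real.sqrt s * fL L (Real.sqrt s) ≤ L * s := by
  unfold fL
  have h1 := Real.sqrt_nonneg s
  have h2 := Real.sqrt_nonneg L
  obtain ⟨h3, h4⟩ := aux_tanh (x := Real.sqrt s * Real.sqrt L / 2) (by positivity)
  refine ⟨by positivity, ?_⟩
  calc _ ≤ Real.sqrt s * (2 * Real.sqrt L * (Real.sqrt s * Real.sqrt L / 2)) := by gcongr
    _ = (Real.sqrt L * Real.sqrt L) * (Real.sqrt s * Real.sqrt s) := by ring
    _ = L * s := by rw [Real.mul_self_sqrt hL.le, Real.mul_self_sqrt hs]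

/-- explicit upper and lower bounds for any solution `ᾱ` of the
fixed point equation `ᾱ = α_ν - 1/T + G(ᾱ,2)/(2T²)` in `(α_ν - 1/T, ∞)`. -/
theorem stmt1 (T βμ αν L abar : ℝ) (hT : 0 < T) (hβ : 0 < βμ) (hαν : 0 < αν) (hL : 0 < L)
    (hmem : αν - 1/T < abar)
    (hfix : abar = αν - 1/T + Gfun T βμ L abar 2 / (2*T^2)) :
    αν/2 - 1/T - L/(2*T^2*αν*βμ) +
        (1/2) * Real.sqrt ((αν + L/(T^2*βμ*αν))^2 + 4*αν/(T^2*βμ)) ≤ abar ∧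
    abar ≤ αν/2 - 1/T + (1/2) * Real.sqrt (αν^2 + 4*αν/(T^2*βμ)) := by
  obtain ⟨A, rfl⟩ : ∃ A, abar = A - 1/T := ⟨abar + 1/T, by ring⟩
  have hA : αν < A := by linarith
  have hA0 : 0 < A := by linarith
  have h1 : 1 + T * (A - 1/T) = T * A := by field_simp; ring
  have hG : Gfun T βμ L (A - 1/T) 2 = 2 * T^2 * (A - αν) := by
    have : A - αν = Gfun T βμ L (A - 1/T) 2 / (2*T^2) := by linarith
    rw [this]; field_simp
  have hFlo : ∀ s, 0 ≤ s → s * (βμ + 1/(T^2*A)) ≤ Ffun T βμ L (A - 1/T) s := by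
    intro s hs
    unfold Ffun
    rw [h1]
    have h2 : 0 ≤ Real.sqrt s * fL L (Real.sqrt s) / (T * A)^2 :=
      div_nonneg (aux_f hL hs).1 (by positivity)
    have h3 : s / (T * (T * A)) = s * (1/(T^2*A)) := by field_simp
    rw [h3]; nlinarith
  have hFhi : ∀ s, 0 ≤ s →
      Ffun T βμ L (A - 1/T) s ≤ s * (βμ + 1/(T^2*A) + L/(T^2*A^2)) := by
    intro s hs
    unfold Ffun
    rw [h1]
    have h2 : Real.sqrt s * fL L (Real.sqrt s) / (T * A)^2 ≤ L * s / (T*A)^2 :=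
      div_le_div_of_nonneg_right (aux_f hL hs).2 (by positivity)
    have h3 : s / (T * (T * A)) = s * (1/(T^2*A)) := by field_simp
    have h4 : L * s / (T*A)^2 = s * (L/(T^2*A^2)) := by field_simp
    rw [h4] at h2
    rw [h3]; nlinarith
  have hp : 0 < βμ + 1/(T^2*A) := by positivity
  have hq : 0 < βμ + 1/(T^2*A) + L/(T^2*A^2) := by positivity
  have hs0 : 2 / (βμ + 1/(T^2*A)) ∈ {s : ℝ | 0 ≤ s ∧ 2 ≤ Ffun T βμ L (A - 1/T) s} := by
    have h0 : 0 ≤ 2 / (βμ + 1/(T^2*A)) := by positivity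
    refine ⟨h0, le_trans (le_of_eq ?_) (hFlo _ h0)⟩
    rw [div_mul_cancel₀ _ hp.ne']
  have hup : 2 * T^2 * (A - αν) ≤ 2 / (βμ + 1/(T^2*A)) := by
    rw [← hG]
    exact csInf_le ⟨0, fun s hs => hs.1⟩ hs0
  have hlo : 2 / (βμ + 1/(T^2*A) + L/(T^2*A^2)) ≤ 2 * T^2 * (A - αν) := by
    rw [← hG]
    refine le_csInf ⟨_, hs0⟩ ?_
    rintro s ⟨hs, hs2⟩
    rw [div_le_iff₀ hq]
    exact hs2.trans (hFhi s hs)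
  rw [le_div_iff₀ hp] at hup
  rw [div_le_iff₀ hq] at hlo
  obtain ⟨k, hk⟩ : ∃ k, k = αν/(T^2*βμ) := ⟨_, rfl⟩
  obtain ⟨c, hc⟩ : ∃ c, c = L/(T^2*βμ*αν) := ⟨_, rfl⟩
  have hc0 : 0 < c := by rw [hc]; positivity
  have e1 : 4*αν/(T^2*βμ) = 4*k := by rw [hk]; ring
  have e2 : L/(2*T^2*αν*βμ) = c/2 := by rw [hc]; field_simp
  have e3 : k * (T^2*βμ) = αν := by rw [hk]; field_simp
  have e4 : c * αν * (T^2*βμ) = L := by rw [hc]; field_simp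
  have hTb : 0 < T^2*βμ := by positivity
  have hup2 : A^2 - αν*A - k ≤ 0 := by
    have h : 2 * T^2 * (A - αν) * (βμ + 1/(T^2*A)) = 2 + 2*(T^2*βμ)*(A^2 - αν*A - k)/A := by
      rw [hk]; field_simp; ring
    rw [h] at hup
    have h5 : 2*(T^2*βμ)*(A^2 - αν*A - k)/A ≤ 0 := by linarith
    by_contra hcon
    push Not at hcon
    have : 0 < 2*(T^2*βμ)*(A^2 - αν*A - k)/A := by positivity
    linarith
  have hlo2 : 0 ≤ A^2 - αν*A - k + c*(A-αν) := by
    have h : 2 * T^2 * (A - αν) * (βμ + 1/(T^2*A) + L/(T^2*A^2))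
        = 2 + 2*(T^2*βμ)*(A*(A^2 - αν*A - k) + c*αν*(A-αν))/A^2 := by
      rw [hk, hc]; field_simp; ring
    rw [h] at hlo
    have h5 : 0 ≤ 2*(T^2*βμ)*(A*(A^2 - αν*A - k) + c*αν*(A-αν))/A^2 := by linarith
    by_contra hcon
    push Not at hcon
    have h6 : A*(A^2 - αν*A - k) + c*αν*(A-αν) < 0 := by
      have h7 : A * (A^2 - αν*A - k + c*(A-αν)) < 0 := mul_neg_of_pos_of_neg hA0 hcon
      have h8 : 0 ≤ c * (A-αν) * (A-αν) :=
        mul_nonneg (mul_nonneg hc0.le (by linarith)) (by linarith)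
      nlinarith
    have : 2*(T^2*βμ)*(A*(A^2 - αν*A - k) + c*αν*(A-αν))/A^2 < 0 :=
      div_neg_of_neg_of_pos (mul_neg_of_pos_of_neg (by positivity) h6) (by positivity)
    linarith
  rw [e1, e2, ← hc]
  constructor
  · have : Real.sqrt ((αν + c)^2 + 4*k) ≤ 2*A - αν + c := by
      apply Real.sqrt_le_iff.2
      exact ⟨by linarith, by nlinarith⟩
    linarith
  · have : 2*A - αν ≤ Real.sqrt (αν^2 + 4*k) := by
      apply Real.le_sqrt_of_sq_le
      nlinarith
    linarith

end
end

section
/- Let T, β_μ, α_ν > 0 and L ≥ 0. The fixed point equation α = α_ν − 1/T + G(α, 2)/(2T²) admits at least one solution α in the interval (α_ν − 1/T, ∞), and α_ν − 1/T is not an accumulation point of the set of solutions; equivalently, the infimum of the set of solutions is strictly greater than α_ν − 1/T. -/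
open MeasureTheory Real Filter
open scoped RealInnerProductSpace

noncomputable section

theorem aux_tanh_nonneg {x : ℝ} (hx : 0 ≤ x) : 0 ≤ Real.tanh x := by
  rw [Real.tanh_eq_sinh_div_cosh]
  exact div_nonneg (Real.sinh_nonneg_iff.2 hx) (Real.cosh_pos x).le

theorem aux_tanh_le {x : ℝ} (hx : 0 ≤ x) : Real.tanh x ≤ x := by
  rw [Real.tanh_eq_sinh_div_cosh, div_le_iff₀ (Real.cosh_pos x)]
  have hm : MonotoneOn (fun y : ℝ => y * Real.cosh y - Real.sinh y) (Set.Ici 0) := by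
    have hd : ∀ y : ℝ, HasDerivAt (fun y : ℝ => y * Real.cosh y - Real.sinh y)
        (1 * Real.cosh y + y * Real.sinh y - Real.cosh y) y := fun y =>
      ((hasDerivAt_id y).mul (Real.hasDerivAt_cosh y)).sub (Real.hasDerivAt_sinh y)
    apply monotoneOn_of_deriv_nonneg (convex_Ici 0)
    · exact fun y _ => (hd y).continuousAt.continuousWithinAt
    · exact fun y _ => (hd y).differentiableAt.differentiableWithinAt
    · intro y hy
      rw [interior_Ici] at hy
      rw [(hd y).deriv]
      have h1 : (0:ℝ) < y := hy
      have := mul_nonneg h1.le (Real.sinh_nonneg_iff.2 h1.le)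
      linarith
  have := hm (Set.mem_Ici.2 le_rfl) (Set.mem_Ici.2 hx) hx
  simp at this
  linarith

theorem aux_q (L s : ℝ) (hL : 0 ≤ L) (hs : 0 ≤ s) :
    0 ≤ Real.sqrt s * fL L (Real.sqrt s) ∧ Real.sqrt s * fL L (Real.sqrt s) ≤ L * s := by
  have hx : 0 ≤ Real.sqrt s * Real.sqrt L / 2 := by positivity
  have h0 := aux_tanh_nonneg hx
  have h1 := aux_tanh_le hx
  unfold fL
  refine ⟨by positivity, ?_⟩
  calc _ ≤ Real.sqrt s * (2 * Real.sqrt L * (Real.sqrt s * Real.sqrt L / 2)) := by gcongr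
    _ = (Real.sqrt L * Real.sqrt L) * (Real.sqrt s * Real.sqrt s) := by ring
    _ = L * s := by rw [Real.mul_self_sqrt hL, Real.mul_self_sqrt hs]

theorem aux_F_anti (T βμ L α α' s : ℝ) (hT : 0 < T) (hL : 0 ≤ L) (hs : 0 ≤ s)
    (h0 : 0 < 1 + T * α) (h : α ≤ α') : Ffun T βμ L α' s ≤ Ffun T βμ L α s := by
  have hq := (aux_q L s hL hs).1
  unfold Ffun
  gcongr

theorem aux_F_lower (T βμ L α s : ℝ) (hT : 0 < T) (hL : 0 ≤ L) (hs : 0 ≤ s)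
    (h0 : 0 < 1 + T * α) : βμ * s ≤ Ffun T βμ L α s := by
  have hq := (aux_q L s hL hs).1
  unfold Ffun
  have h1 : 0 ≤ s / (T * (1 + T * α)) := by positivity
  have h2 : 0 ≤ Real.sqrt s * fL L (Real.sqrt s) / (1 + T * α) ^ 2 := by positivity
  linarith

theorem aux_mem (T βμ L α : ℝ) (hT : 0 < T) (hβ : 0 < βμ) (hL : 0 ≤ L)
    (h0 : 0 < 1 + T * α) : 2 / βμ ∈ {s : ℝ | 0 ≤ s ∧ 2 ≤ Ffun T βμ L α s} := by
  have hs : 0 ≤ 2 / βμ := by positivity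
  refine ⟨hs, ?_⟩
  have := aux_F_lower T βμ L α _ hT hL hs h0
  rwa [mul_div_cancel₀ _ hβ.ne'] at this

theorem aux_bdd (T βμ L α : ℝ) : BddBelow {s : ℝ | 0 ≤ s ∧ 2 ≤ Ffun T βμ L α s} :=
  ⟨0, fun _ hs => hs.1⟩

theorem aux_G_mono (T βμ L α α' : ℝ) (hT : 0 < T) (hβ : 0 < βμ) (hL : 0 ≤ L)
    (h0 : 0 < 1 + T * α) (h : α ≤ α') : Gfun T βμ L α 2 ≤ Gfun T βμ L α' 2 := by
  have h0' : 0 < 1 + T * α' := by nlinarith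
  exact csInf_le_csInf (aux_bdd T βμ L α) ⟨_, aux_mem T βμ L α' hT hβ hL h0'⟩
    fun s hs => ⟨hs.1, hs.2.trans (aux_F_anti T βμ L α α' s hT hL hs.1 h0 h)⟩

theorem aux_G_lower (T βμ L α : ℝ) (hT : 0 < T) (hβ : 0 < βμ) (hL : 0 ≤ L)
    (h0 : 0 < 1 + T * α) : 0 < Gfun T βμ L α 2 := by
  have hK : 0 < βμ + 1 / (T * (1 + T * α)) + L / (1 + T * α) ^ 2 := by positivity
  refine lt_of_lt_of_le (div_pos two_pos hK)
    (le_csInf ⟨_, aux_mem T βμ L α hT hβ hL h0⟩ fun s hs => ?_)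
  rw [div_le_iff₀ hK]
  refine hs.2.trans ?_
  have hq := (aux_q L s hL hs.1).2
  calc Ffun T βμ L α s ≤ βμ * s + s / (T * (1 + T * α)) + L * s / (1 + T * α) ^ 2 := by
        unfold Ffun; gcongr
    _ = _ := by ring

theorem aux_fix (f : ℝ → ℝ) (a b : ℝ) (hf : ∀ x y, a ≤ x → x ≤ y → f x ≤ f y)
    (ha : a ≤ f a) (hb : ∀ x, a ≤ x → f x ≤ b) : ∃ c, a ≤ c ∧ c = f c := by
  have hbd : BddAbove {x | a ≤ x ∧ x ≤ f x} := ⟨b, fun x hx => hx.2.trans (hb x hx.1)⟩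
  have hac : a ≤ sSup {x | a ≤ x ∧ x ≤ f x} := le_csSup hbd ⟨le_rfl, ha⟩
  have h1 : sSup {x | a ≤ x ∧ x ≤ f x} ≤ f (sSup {x | a ≤ x ∧ x ≤ f x}) :=
    csSup_le ⟨a, le_rfl, ha⟩ fun x hx => hx.2.trans (hf _ _ hx.1 (le_csSup hbd hx))
  exact ⟨_, hac, le_antisymm h1 (le_csSup hbd ⟨hac.trans h1, hf _ _ hac h1⟩)⟩

/-- the fixed point equation `α = α_ν - 1/T + G(α,2)/(2T²)` has a
solution in `(α_ν - 1/T, ∞)`, and the infimum of the set of solutions in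
`[α_ν - 1/T, ∞)` is strictly greater than `α_ν - 1/T`. -/
theorem stmt9 (T βμ αν L : ℝ) (hT : 0 < T) (hβ : 0 < βμ) (hαν : 0 < αν) (hL : 0 ≤ L) :
    (∃ α : ℝ, αν - 1/T < α ∧ α = αν - 1/T + Gfun T βμ L α 2 / (2*T^2)) ∧
    (∃ ε : ℝ, 0 < ε ∧ ∀ α : ℝ, αν - 1/T ≤ α →
      α = αν - 1/T + Gfun T βμ L α 2 / (2*T^2) → αν - 1/T + ε ≤ α) := by
  have hpos : 0 < 1 + T * (αν - 1/T) := by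
    have : 1 + T * (αν - 1/T) = T * αν := by field_simp; ring
    rw [this]; positivity
  have hpos' : ∀ α, αν - 1/T ≤ α → 0 < 1 + T * α := fun α h => by nlinarith
  have hg := aux_G_lower T βμ L (αν - 1/T) hT hβ hL hpos
  have hε : 0 < Gfun T βμ L (αν - 1/T) 2 / (2*T^2) := by positivity
  have hm : ∀ x y, αν - 1/T ≤ x → x ≤ y → αν - 1/T + Gfun T βμ L x 2 / (2*T^2) ≤
      αν - 1/T + Gfun T βμ L y 2 / (2*T^2) := fun x y hx hxy => by
    have := aux_G_mono T βμ L x y hT hβ hL (hpos' x hx) hxy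
    gcongr
  have key : ∀ α : ℝ, αν - 1/T ≤ α → α = αν - 1/T + Gfun T βμ L α 2 / (2*T^2) →
      αν - 1/T + Gfun T βμ L (αν - 1/T) 2 / (2*T^2) ≤ α := fun α h h' =>
    (hm _ α le_rfl h).trans h'.symm.le
  refine ⟨?_, _, hε, key⟩
  obtain ⟨c, hc, hc'⟩ := aux_fix (fun α => αν - 1/T + Gfun T βμ L α 2 / (2*T^2)) (αν - 1/T)
    (αν - 1/T + (2 / βμ) / (2*T^2)) hm (by linarith) (fun x hx => by
      have : Gfun T βμ L x 2 ≤ 2 / βμ :=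
        csInf_le (aux_bdd T βμ L x) (aux_mem T βμ L x hT hβ hL (hpos' x hx))
      gcongr)
  exact ⟨c, by linarith [key c hc hc'], hc'⟩

end
end

section
/- Let T > 0, α > −1/T, and let ψ : ℝ^d → ℝ be measurable such that ∫ exp(−|y−x|²/(2T) − ψ(y)) dy ∈ (0, ∞) for all x ∈ ℝ^d. Set ψ̂(y) = ψ(y) − (α/2)|y|². Then for all x ∈ ℝ^d the integral ∫ exp(−(1+Tα)|y − (1+Tα)⁻¹x|²/(2T) − ψ̂(y)) dy is finite and there exists a constant C ∈ ℝ, independent of x, such that −log((2πT)^{−d/2} ∫ exp(−|y−x|²/(2T) − ψ(y)) dy) = α|x|²/(2(1+Tα)) − log((2πT/(1+Tα))^{−d/2} ∫ exp(−(1+Tα)|y − (1+Tα)⁻¹x|²/(2T) − ψ̂(y)) dy) + C. -/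
open MeasureTheory Real Filter
open scoped RealInnerProductSpace

noncomputable section

/-- the space-time transformation identity for the Hopf–Cole
transform, with `ψ̂(y) = ψ(y) - (α/2)|y|²`. -/
theorem stmt12 {d : ℕ} (T α : ℝ) (hT : 0 < T) (hα : -1/T < α)
    (ψ : Euc d → ℝ) (hmeas : Measurable ψ)
    (hint : ∀ x : Euc d,
      Integrable (fun y : Euc d => Real.exp (-‖y - x‖^2/(2*T) - ψ y)))
    (hpos : ∀ x : Euc d,
      0 < ∫ y : Euc d, Real.exp (-‖y - x‖^2/(2*T) - ψ y)) :
    (∀ x : Euc d, Integrable (fun y : Euc d =>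
      Real.exp (-((1+T*α) * ‖y - (1+T*α)⁻¹ • x‖^2)/(2*T) - (ψ y - α/2 * ‖y‖^2)))) ∧
    ∃ C : ℝ, ∀ x : Euc d,
      -Real.log ((2*π*T) ^ (-(d:ℝ)/2) *
          ∫ y : Euc d, Real.exp (-‖y - x‖^2/(2*T) - ψ y)) =
        α * ‖x‖^2 / (2*(1+T*α)) -
        Real.log ((2*π*T/(1+T*α)) ^ (-(d:ℝ)/2) *
          ∫ y : Euc d, Real.exp (-((1+T*α) * ‖y - (1+T*α)⁻¹ • x‖^2)/(2*T)
            - (ψ y - α/2 * ‖y‖^2))) + C := by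
  have hs : 0 < 1 + T * α := by
    rw [div_lt_iff₀ hT] at hα
    linarith
  have key : ∀ x y : Euc d,
      Real.exp (-((1+T*α) * ‖y - (1+T*α)⁻¹ • x‖^2)/(2*T) - (ψ y - α/2 * ‖y‖^2)) =
      Real.exp (α * ‖x‖^2 / (2*(1+T*α))) * Real.exp (-‖y - x‖^2/(2*T) - ψ y) := by
    intro x y
    rw [← Real.exp_add]
    congr 1
    rw [norm_sub_sq_real, norm_sub_sq_real, inner_smul_right, norm_smul, Real.norm_eq_abs,
      mul_pow, sq_abs]
    generalize ‖x‖ = a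
    generalize ‖y‖ = b
    generalize ⟪y, x⟫ = c
    have h1 := hs.ne'
    have h2 := hT.ne'
    field_simp
    ring
  simp only [key]
  refine ⟨fun x => (hint x).const_mul _,
    Real.log ((2*π*T/(1+T*α)) ^ (-(d:ℝ)/2)) - Real.log ((2*π*T) ^ (-(d:ℝ)/2)), fun x => ?_⟩
  have hA : (0:ℝ) < (2*π*T) ^ (-(d:ℝ)/2) := Real.rpow_pos_of_pos (by positivity) _
  have hB : (0:ℝ) < (2*π*T/(1+T*α)) ^ (-(d:ℝ)/2) := Real.rpow_pos_of_pos (by positivity) _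
  rw [integral_const_mul, Real.log_mul hA.ne' (hpos x).ne',
    Real.log_mul hB.ne' (mul_pos (Real.exp_pos _) (hpos x)).ne',
    Real.log_mul (Real.exp_pos _).ne' (hpos x).ne', Real.log_exp]
  ring

end
end

section
/- Let T, β_μ > 0, L ≥ 0 and α > −1/T. Let W : ℝ → ℝ be continuously differentiable such that e^{−W}, x²e^{−W(x)} and (1+|x|)|W'(x)|e^{−W(x)} are Lebesgue integrable, (1+|x|)e^{−W(x)} → 0 as |x| → ∞, and (W'(x) − W'(x̂))(x − x̂) ≤ F(α, (x − x̂)²) for all x, x̂ ∈ ℝ. Let ρ be the probability measure on ℝ with density proportional to e^{−W}. Then the variance of ρ satisfies Var_ρ ≥ G(α, 2)/2. -/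
open MeasureTheory Real Filter
open scoped RealInnerProductSpace

noncomputable section

lemma aux_tanh_deriv (c r : ℝ) :
    HasDerivAt (fun r => Real.tanh (c * r)) (c / Real.cosh (c * r) ^ 2) r := by
  have hc : Real.cosh (c * r) ≠ 0 := (Real.cosh_pos _).ne'
  have h0 : HasDerivAt (fun r : ℝ => c * r) c r := by
    simpa using (hasDerivAt_id r).const_mul c
  have h := (h0.sinh).div (h0.cosh) hc
  have e : (fun r => Real.tanh (c * r)) = (fun r => Real.sinh (c * r)) / fun r => Real.cosh (c * r) := by
    funext x; simp [Real.tanh_eq_sinh_div_cosh]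
  rw [e]
  refine h.congr_deriv ?_
  have hs := Real.cosh_sq (c * r)
  congr 1
  linear_combination c * hs

lemma aux_tanh_div (c : ℝ) (hc : 0 ≤ c) :
    AntitoneOn (fun r => Real.tanh (c * r) / r) (Set.Ioi 0) := by
  have hd : ∀ r ∈ Set.Ioi (0:ℝ), HasDerivAt (fun r => Real.tanh (c * r) / r)
      ((c / Real.cosh (c * r) ^ 2 * r - Real.tanh (c * r) * 1) / r ^ 2) r := by
    intro r hr
    exact (aux_tanh_deriv c r).div (hasDerivAt_id r) (ne_of_gt hr)
  apply antitoneOn_of_deriv_nonpos (convex_Ioi 0)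
  · intro r hr; exact (hd r hr).continuousAt.continuousWithinAt
  · intro r hr
    rw [interior_Ioi] at hr
    exact (hd r hr).differentiableAt.differentiableWithinAt
  · intro r hr
    rw [interior_Ioi] at hr
    rw [(hd r hr).deriv]
    have hr0 : 0 < r := hr
    apply div_nonpos_of_nonpos_of_nonneg _ (by positivity)
    rw [Real.tanh_eq_sinh_div_cosh]
    have hp := Real.cosh_pos (c * r)
    have h1 := Real.one_le_cosh (c * r)
    have h2 : c * r ≤ Real.sinh (c * r) := Real.self_le_sinh_iff.2 (by positivity)
    have h3 : 0 ≤ c * r := by positivity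
    have : c / Real.cosh (c * r) ^ 2 * r - Real.sinh (c * r) / Real.cosh (c * r) * 1
        = (c * r - Real.sinh (c * r) * Real.cosh (c * r)) / Real.cosh (c * r) ^ 2 := by
      field_simp
    rw [this]
    apply div_nonpos_of_nonpos_of_nonneg _ (by positivity)
    nlinarith

lemma aux_tangent (c : ℝ) (hc : 0 ≤ c) (r0 : ℝ) (hr0 : 0 < r0) :
    ∃ m : ℝ, 0 ≤ m ∧ ∀ r : ℝ, 0 ≤ r →
      r * Real.tanh (c * r) ≤ r0 * Real.tanh (c * r0) + m * (r ^ 2 - r0 ^ 2) := by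
  have htn : ∀ r : ℝ, 0 ≤ r → 0 ≤ Real.tanh (c * r) := by
    intro r hr
    rw [Real.tanh_eq_sinh_div_cosh]
    exact div_nonneg (Real.sinh_nonneg_iff.2 (by positivity)) (Real.cosh_pos _).le
  set q : ℝ → ℝ := fun r => Real.tanh (c * r) / r + c / Real.cosh (c * r) ^ 2 with hq
  have hqa : AntitoneOn q (Set.Ioi 0) := by
    intro x hx y hy hxy
    have hx0 : 0 < x := hx
    have hy0 : 0 < y := hy
    have h1 := aux_tanh_div c hc hx hy hxy
    have h2 : Real.cosh (c * x) ≤ Real.cosh (c * y) := by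
      rw [Real.cosh_le_cosh, abs_of_nonneg (by positivity), abs_of_nonneg (by positivity)]
      gcongr
    have hp := Real.cosh_pos (c * x)
    have h3 : c / Real.cosh (c * y) ^ 2 ≤ c / Real.cosh (c * x) ^ 2 := by gcongr
    exact add_le_add h1 h3
  set m := q r0 / 2 with hm
  have hd : ∀ r : ℝ, HasDerivAt (fun r => r * Real.tanh (c * r) - m * r ^ 2)
      (1 * Real.tanh (c * r) + r * (c / Real.cosh (c * r) ^ 2) - m * (2 * r)) r := by
    intro r
    have h2 : HasDerivAt (fun r : ℝ => m * r ^ 2) (m * (2 * r)) r := by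
      simpa using (hasDerivAt_pow 2 r).const_mul m
    exact ((hasDerivAt_id r).mul (aux_tanh_deriv c r)).sub h2
  have hd' : ∀ r : ℝ, 0 < r → deriv (fun r => r * Real.tanh (c * r) - m * r ^ 2) r
      = r * (q r - q r0) := by
    intro r hr
    rw [(hd r).deriv, hm]
    simp only [hq]
    field_simp
  have hcont : Continuous (fun r => r * Real.tanh (c * r) - m * r ^ 2) :=
    continuous_iff_continuousAt.2 fun r => (hd r).continuousAt
  have hdiff : Differentiable ℝ (fun r => r * Real.tanh (c * r) - m * r ^ 2) :=
    fun r => (hd r).differentiableAt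
  refine ⟨m, ?_, ?_⟩
  · have := htn r0 hr0.le
    simp only [hm, hq]
    positivity
  · intro r hr
    rcases le_total r r0 with h | h
    · have hmono : MonotoneOn (fun r => r * Real.tanh (c * r) - m * r ^ 2) (Set.Icc 0 r0) := by
        apply monotoneOn_of_deriv_nonneg (convex_Icc 0 r0) hcont.continuousOn
          hdiff.differentiableOn
        intro x hx
        rw [interior_Icc] at hx
        rw [hd' x hx.1]
        have := hqa (Set.mem_Ioi.2 hx.1) (Set.mem_Ioi.2 hr0) hx.2.le
        exact mul_nonneg hx.1.le (by linarith)
      have := hmono ⟨hr, h⟩ ⟨hr0.le, le_refl _⟩ h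
      simp only at this
      linarith
    · have hanti : AntitoneOn (fun r => r * Real.tanh (c * r) - m * r ^ 2) (Set.Ici r0) := by
        apply antitoneOn_of_deriv_nonpos (convex_Ici r0) hcont.continuousOn
          hdiff.differentiableOn
        intro x hx
        rw [interior_Ici] at hx
        have hx' : r0 < x := hx
        have hx0 : 0 < x := hr0.trans hx'
        rw [hd' x hx0]
        have := hqa (Set.mem_Ioi.2 hr0) (Set.mem_Ioi.2 hx0) hx'.le
        exact mul_nonpos_of_nonneg_of_nonpos hx0.le (by linarith)
      have := hanti (Set.mem_Ici.2 le_rfl) (Set.mem_Ici.2 h) h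
      simp only at this
      linarith

lemma aux_Ffun (T βμ L α : ℝ) (hT : 0 < T) (hβ : 0 < βμ) (ha : 0 < 1 + T * α)
    (s1 : ℝ) (hs1 : 0 < s1) :
    ∃ m : ℝ, 0 ≤ m ∧ ∀ s : ℝ, 0 ≤ s →
      Ffun T βμ L α s ≤ Ffun T βμ L α s1 + m * (s - s1) := by
  obtain ⟨m, hm, h⟩ := aux_tangent (Real.sqrt L / 2) (by positivity) (Real.sqrt s1)
    (Real.sqrt_pos.2 hs1)
  refine ⟨βμ + 1 / (T * (1 + T * α)) + 2 * Real.sqrt L / (1 + T * α) ^ 2 * m,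
    by positivity, ?_⟩
  intro s hs
  have h' := h (Real.sqrt s) (Real.sqrt_nonneg s)
  rw [Real.sq_sqrt hs, Real.sq_sqrt hs1.le] at h'
  have hk : 0 ≤ 2 * Real.sqrt L / (1 + T * α) ^ 2 := by positivity
  have h'' := mul_le_mul_of_nonneg_left h' hk
  have e : ∀ s, Ffun T βμ L α s = (βμ + 1 / (T * (1 + T * α))) * s +
      2 * Real.sqrt L / (1 + T * α) ^ 2 *
        (Real.sqrt s * Real.tanh (Real.sqrt L / 2 * Real.sqrt s)) := by
    intro s
    unfold Ffun fL
    rw [show Real.sqrt s * Real.sqrt L / 2 = Real.sqrt L / 2 * Real.sqrt s by ring]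
    ring
  rw [e, e]
  linarith

/-- one-dimensional variance lower bound `Var_ρ ≥ G(α,2)/2` for
`ρ ∝ e^{-W}` when `(W'(x) - W'(x̂))(x - x̂) ≤ F(α, (x-x̂)²)`. -/
theorem stmt14 (T βμ L α : ℝ) (hT : 0 < T) (hβ : 0 < βμ) (hL : 0 ≤ L) (hα : -1/T < α)
    (W : ℝ → ℝ) (hW : ContDiff ℝ 1 W)
    (h1 : Integrable (fun x : ℝ => Real.exp (-W x)))
    (h2 : Integrable (fun x : ℝ => x^2 * Real.exp (-W x)))
    (h3 : Integrable (fun x : ℝ => (1 + |x|) * |deriv W x| * Real.exp (-W x)))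
    (h4 : Filter.Tendsto (fun x : ℝ => (1 + |x|) * Real.exp (-W x))
      (Filter.cocompact ℝ) (nhds 0))
    (h5 : ∀ x xh : ℝ, (deriv W x - deriv W xh) * (x - xh) ≤ Ffun T βμ L α ((x - xh)^2))
    (ρ : Measure ℝ)
    (hρ : ρ = (ENNReal.ofReal (∫ x : ℝ, Real.exp (-W x)))⁻¹ •
      (volume.withDensity fun x : ℝ => ENNReal.ofReal (Real.exp (-W x)))) :
    Gfun T βμ L α 2 / 2 ≤ (∫ x : ℝ, x^2 ∂ρ) - (∫ x : ℝ, x ∂ρ)^2 := by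
  have ha : 0 < 1 + T * α := by
    rw [div_lt_iff₀ hT] at hα
    linarith
  have hWc : Continuous W := hW.continuous
  have hW'c : Continuous (deriv W) := hW.continuous_deriv le_rfl
  have hWd : ∀ x, HasDerivAt W (deriv W x) x := fun x =>
    (hW.differentiable one_ne_zero x).hasDerivAt
  set Z : ℝ := ∫ x : ℝ, Real.exp (-W x) with hZ
  have hZpos : 0 < Z := by
    rw [hZ]
    exact integral_exp_pos h1
  have hmeas : Measurable fun x : ℝ => ENNReal.ofReal (Real.exp (-W x)) := by
    fun_prop
  have hfin : ∀ᵐ x : ℝ, ENNReal.ofReal (Real.exp (-W x)) < ⊤ :=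
    ae_of_all _ fun _ => ENNReal.ofReal_lt_top
  have hint : ∀ g : ℝ → ℝ, Integrable (fun x => g x * Real.exp (-W x)) → Integrable g ρ := by
    intro g hg
    rw [hρ]
    apply Integrable.smul_measure
    · rw [integrable_withDensity_iff hmeas hfin]
      simpa [ENNReal.toReal_ofReal (Real.exp_pos _).le] using hg
    · simp [hZpos]
  have hval : ∀ g : ℝ → ℝ, ∫ x, g x ∂ρ = Z⁻¹ * ∫ x, g x * Real.exp (-W x) := by
    intro g
    rw [hρ, integral_smul_measure, integral_withDensity_eq_integral_toReal_smul hmeas hfin]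
    simp [ENNReal.toReal_ofReal (Real.exp_pos _).le, ENNReal.toReal_ofReal hZpos.le, mul_comm]
  have hprob : IsProbabilityMeasure ρ := by
    constructor
    rw [hρ]
    simp only [Measure.smul_apply, smul_eq_mul]
    rw [withDensity_apply _ MeasurableSet.univ, Measure.restrict_univ,
      ← ofReal_integral_eq_lintegral_ofReal h1 (ae_of_all _ fun x => (Real.exp_pos _).le)]
    exact ENNReal.inv_mul_cancel (by simp [hZpos]) ENNReal.ofReal_ne_top
  -- Lebesgue integrability
  have i1 : Integrable (fun x : ℝ => x * Real.exp (-W x)) := by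
    refine (h1.add h2).mono' (by fun_prop) (ae_of_all _ fun x => ?_)
    have := Real.exp_pos (-W x)
    simp only [norm_mul, Real.norm_eq_abs, Pi.add_apply, abs_of_pos this]
    have h : |x| ≤ 1 + x ^ 2 := by nlinarith [sq_abs x, sq_nonneg (|x| - 1), abs_nonneg x]
    nlinarith
  have i2 : Integrable (fun x : ℝ => deriv W x * Real.exp (-W x)) := by
    refine h3.mono' (by fun_prop) (ae_of_all _ fun x => ?_)
    have := Real.exp_pos (-W x)
    simp only [norm_mul, Real.norm_eq_abs, abs_of_pos this]
    have h : |deriv W x| ≤ (1 + |x|) * |deriv W x| := by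
      nlinarith [mul_nonneg (abs_nonneg x) (abs_nonneg (deriv W x))]
    exact mul_le_mul_of_nonneg_right h this.le
  have i3 : Integrable (fun x : ℝ => (x * deriv W x) * Real.exp (-W x)) := by
    refine h3.mono' (by fun_prop) (ae_of_all _ fun x => ?_)
    have := Real.exp_pos (-W x)
    simp only [norm_mul, Real.norm_eq_abs, abs_of_pos this]
    have h : |x| * |deriv W x| ≤ (1 + |x|) * |deriv W x| := by
      nlinarith [abs_nonneg (deriv W x)]
    exact mul_le_mul_of_nonneg_right h this.le
  have hE : ∀ x, HasDerivAt (fun x => Real.exp (-W x)) (Real.exp (-W x) * -deriv W x) x :=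
    fun x => (hWd x).neg.exp
  have t1 : Tendsto (fun x : ℝ => Real.exp (-W x)) (cocompact ℝ) (nhds 0) := by
    refine squeeze_zero (fun x => (Real.exp_pos _).le) (fun x => ?_) h4
    nlinarith [mul_nonneg (abs_nonneg x) (Real.exp_pos (-W x)).le]
  have t2 : Tendsto (fun x : ℝ => x * Real.exp (-W x)) (cocompact ℝ) (nhds 0) := by
    refine squeeze_zero_norm (fun x => ?_) h4
    have := Real.exp_pos (-W x)
    simp only [norm_mul, Real.norm_eq_abs, abs_of_pos this]
    nlinarith
  rw [cocompact_eq_atBot_atTop, tendsto_sup] at t1 t2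
  have e1 : ∫ x, deriv W x ∂ρ = 0 := by
    rw [hval]
    have := integral_of_hasDerivAt_of_tendsto hE
      (by convert i2.neg using 2; simp; ring) t1.1 t1.2
    have h' : ∫ x, deriv W x * Real.exp (-W x) = - ∫ x, Real.exp (-W x) * -deriv W x := by
      rw [← integral_neg]; congr 1; funext x; ring
    rw [h', this]; simp
  have e2 : ∫ x, x * deriv W x ∂ρ = 1 := by
    rw [hval]
    have hE2 : ∀ x, HasDerivAt (fun x => x * Real.exp (-W x))
        (1 * Real.exp (-W x) + x * (Real.exp (-W x) * -deriv W x)) x :=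
      fun x => (hasDerivAt_id x).mul (hE x)
    have := integral_of_hasDerivAt_of_tendsto hE2
      (by convert h1.sub i3 using 2; simp; ring) t2.1 t2.2
    have h' : ∫ x, (1 * Real.exp (-W x) + x * (Real.exp (-W x) * -deriv W x))
        = Z - ∫ x, x * deriv W x * Real.exp (-W x) := by
      rw [hZ, ← integral_sub h1 i3]; congr 1; funext x; ring
    rw [h'] at this
    have h'' : ∫ x, x * deriv W x * Real.exp (-W x) = Z := by linarith
    rw [h'']
    exact inv_mul_cancel₀ hZpos.ne'
  have j1 : Integrable (fun x : ℝ => x) ρ := hint _ i1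
  have j2 : Integrable (fun x : ℝ => x ^ 2) ρ := hint _ h2
  have j3 : Integrable (deriv W) ρ := hint _ i2
  have j4 : Integrable (fun x : ℝ => x * deriv W x) ρ := hint _ i3
  set M : ℝ := ∫ x, x ∂ρ with hM
  set V : ℝ := ∫ x, x ^ 2 ∂ρ with hV
  -- integral of a general combination
  have comb : ∀ a b c d e : ℝ,
      Integrable (fun x => a * (x * deriv W x) + b * deriv W x + c * x ^ 2 + d * x + e) ρ ∧
      ∫ x, (a * (x * deriv W x) + b * deriv W x + c * x ^ 2 + d * x + e) ∂ρ
        = a + c * V + d * M + e := by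
    intro a b c d e
    have k1 := j4.const_mul a
    have k2 := j3.const_mul b
    have k3 := j2.const_mul c
    have k4 := j1.const_mul d
    have k5 : Integrable (fun _ : ℝ => e) ρ := integrable_const e
    have s2 : Integrable (fun x => a * (x * deriv W x) + b * deriv W x) ρ := k1.add k2
    have s3 : Integrable (fun x => a * (x * deriv W x) + b * deriv W x + c * x ^ 2) ρ := s2.add k3
    have s4 : Integrable (fun x => a * (x * deriv W x) + b * deriv W x + c * x ^ 2 + d * x) ρ :=
      s3.add k4
    refine ⟨s4.add k5, ?_⟩
    rw [integral_add s4 k5, integral_add s3 k4, integral_add s2 k3, integral_add k1 k2,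
      integral_const_mul, integral_const_mul, integral_const_mul, integral_const_mul, e1, e2]
    simp [hM, hV]
  have hvar : 0 ≤ V - M ^ 2 := by
    have h := (comb 0 0 1 (-2 * M) (M ^ 2)).2
    have h' : 0 ≤ ∫ x, (0 * (x * deriv W x) + 0 * deriv W x + 1 * x ^ 2 + (-2 * M) * x + M ^ 2) ∂ρ :=
      integral_nonneg fun x => by
        simp only [Pi.zero_apply]
        nlinarith [sq_nonneg (x - M)]
    rw [h] at h'
    nlinarith
  suffices h : Gfun T βμ L α 2 ≤ 2 * (V - M ^ 2) by linarith
  apply le_of_forall_gt_imp_ge_of_dense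
  intro s1 hs1
  have hs1p : 0 < s1 := by linarith
  obtain ⟨m, hm, hF⟩ := aux_Ffun T βμ L α hT hβ ha s1 hs1p
  set A := Ffun T βμ L α s1 with hA
  have key : ∀ y : ℝ, 1 - deriv W y * M + y * deriv W y ≤
      A + m * (V - 2 * y * M + y ^ 2 - s1) := by
    intro y
    have l := comb 1 (-y) 0 (-deriv W y) (y * deriv W y)
    have r := comb 0 0 m (-2 * m * y) (A + m * (y ^ 2 - s1))
    have := integral_mono l.1 r.1 (fun x => by
      have := (h5 x y).trans (hF _ (sq_nonneg _))
      simp only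
      nlinarith)
    rw [l.2, r.2] at this
    nlinarith
  have fin : 2 ≤ A := by
    have l := comb 1 (-M) 0 0 1
    have r := comb 0 0 m (-2 * m * M) (A + m * (V - s1))
    have := integral_mono l.1 r.1 (fun y => by
      have := key y
      simp only
      nlinarith)
    rw [l.2, r.2] at this
    nlinarith
  exact csInf_le ⟨0, fun s hs => hs.1⟩ ⟨hs1p.le, fin⟩

end
end

section
/- Let μ be a probability measure on ℝ^d satisfying LSI(C_μ), let K be a Markov kernel from ℝ^d to ℝ^d, and let π be the probability measure on ℝ^d × ℝ^d given by π(dx dy) = μ(dx)K(x)(dy). Suppose there exist constants C̃, C₀ ≥ 0 such that: (a) for every x ∈ ℝ^d and every positive continuously differentiable g : ℝ^d → ℝ with ∫|∇g|²/g dK(x) < ∞, Ent_{K(x)}(g) ≤ (C̃/2)∫|∇g|²/g dK(x); (b) for every continuously differentiable g : ℝ^d → ℝ with bounded gradient, the map x ↦ ∫ g dK(x) is differentiable with |∇_x ∫ g dK(x)|² ≤ C₀·(∫|∇g| dK(x))²; and (c) for every positive continuously differentiable f : ℝ^d × ℝ^d → ℝ, the map f₀(x) = ∫ f(x, y) K(x)(dy)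 is differentiable with ∇f₀(x) = ∫ ∇_x f(x, y) K(x)(dy) + ∇_z(∫ f(x, y) K(z)(dy))|_{z=x}. Then π satisfies LSI with constant max{2C_μ, 2C_μC₀ + C̃}. -/
open MeasureTheory Real Filter
open scoped RealInnerProductSpace

noncomputable section

/-- A measure on `Euc d` satisfies the logarithmic Sobolev inequality with
constant `C`. -/
def HasLSI {d : ℕ} (ρ : Measure (Euc d)) (C : ℝ) : Prop :=
  ∀ f : Euc d → ℝ, (∀ x, 0 < f x) → ContDiff ℝ 1 f →
    Integrable (fun x => ‖gradient f x‖^2 / f x) ρ →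
    (∫ x, f x * Real.log (f x) ∂ρ) - (∫ x, f x ∂ρ) * Real.log (∫ x, f x ∂ρ) ≤
      C/2 * ∫ x, ‖gradient f x‖^2 / f x ∂ρ

/-- The logarithmic Sobolev inequality on the product space `Euc d × Euc d`,
the squared gradient being the sum of the squared partial gradients. -/
def HasLSI2 {d : ℕ} (ρ : Measure (Euc d × Euc d)) (C : ℝ) : Prop :=
  ∀ f : Euc d × Euc d → ℝ, (∀ p, 0 < f p) → ContDiff ℝ 1 f →
    Integrable (fun p => (‖gradient (fun x => f (x, p.2)) p.1‖^2 +
      ‖gradient (fun y => f (p.1, y)) p.2‖^2) / f p) ρ →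
    (∫ p, f p * Real.log (f p) ∂ρ) - (∫ p, f p ∂ρ) * Real.log (∫ p, f p ∂ρ) ≤
      C/2 * ∫ p, (‖gradient (fun x => f (x, p.2)) p.1‖^2 +
        ‖gradient (fun y => f (p.1, y)) p.2‖^2) / f p ∂ρ

section aux
open ProbabilityTheory Topology

theorem aux_norm_gradient {d : ℕ} (f : Euc d → ℝ) (x : Euc d) :
    ‖gradient f x‖ = ‖fderiv ℝ f x‖ := by
  rw [← toDual_gradient, LinearIsometryEquiv.norm_map]

theorem aux_grad1 {d : ℕ} (f : Euc d × Euc d → ℝ) (hf : ContDiff ℝ 1 f) (x y : Euc d) :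
    HasFDerivAt (fun x => f (x, y))
      ((fderiv ℝ f (x, y)).comp (ContinuousLinearMap.inl ℝ (Euc d) (Euc d))) x :=
  ((hf.differentiable one_ne_zero (x, y)).hasFDerivAt).comp x (hasFDerivAt_prodMk_left x y)

theorem aux_grad2 {d : ℕ} (f : Euc d × Euc d → ℝ) (hf : ContDiff ℝ 1 f) (x y : Euc d) :
    HasFDerivAt (fun y => f (x, y))
      ((fderiv ℝ f (x, y)).comp (ContinuousLinearMap.inr ℝ (Euc d) (Euc d))) y :=
  ((hf.differentiable one_ne_zero (x, y)).hasFDerivAt).comp y (hasFDerivAt_prodMk_right x y)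

theorem aux_int_fst {d : ℕ} (μ : Measure (Euc d)) [SFinite μ] (K : Kernel (Euc d) (Euc d))
    [IsMarkovKernel K] (u : Euc d → ℝ) (hu : Integrable u μ) :
    Integrable (fun q : Euc d × Euc d => u q.1) (μ.compProd K) := by
  have h : Integrable u ((μ.compProd K).map Prod.fst) := by
    have : (μ.compProd K).map Prod.fst = μ := Measure.fst_compProd μ K
    rwa [this]
  exact h.comp_measurable measurable_fst

theorem aux_int_compProd {d : ℕ} (μ : Measure (Euc d)) [SFinite μ] (K : Kernel (Euc d) (Euc d))
    [IsMarkovKernel K] (h : Euc d × Euc d → ℝ) (hh : Integrable h (μ.compProd K)) :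
    Integrable (fun x => ∫ y, h (x, y) ∂(K x)) μ := by
  unfold Measure.compProd at hh
  exact hh.integral_compProd

theorem aux_bdd_s18 {α : Type*} [MeasurableSpace α] (ν : Measure α) [IsFiniteMeasure ν] (h : α → ℝ)
    (hm : Measurable h) (M : ℝ) (hM : ∀ x, |h x| ≤ M) : Integrable h ν :=
  Integrable.of_bound hm.aestronglyMeasurable M (Eventually.of_forall hM)

theorem aux_cs {α : Type*} [MeasurableSpace α] (ν : Measure α) (w f c : α → ℝ)
    (hw : ∀ x, 0 ≤ w x) (hf : ∀ x, 0 < f x) (h1 : Integrable (fun x => w x * c x) ν)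
    (h2 : Integrable (fun x => w x * f x) ν) (h3 : Integrable (fun x => w x * (c x ^ 2 / f x)) ν)
    (hp : 0 < ∫ x, w x * f x ∂ν) :
    (∫ x, w x * c x ∂ν) ^ 2 / (∫ x, w x * f x ∂ν) ≤ ∫ x, w x * (c x ^ 2 / f x) ∂ν := by
  set A := ∫ x, w x * c x ∂ν with hA
  set F := ∫ x, w x * f x ∂ν with hF
  have key : ∫ x, (2 * (A / F)) * (w x * c x) - (A / F) ^ 2 * (w x * f x) ∂ν
      ≤ ∫ x, w x * (c x ^ 2 / f x) ∂ν := by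
    apply integral_mono ((h1.const_mul _).sub (h2.const_mul _)) h3
    intro x
    have hfx := hf x
    have : c x ^ 2 / f x - (2 * (A / F) * c x - (A / F) ^ 2 * f x) =
        (c x - A / F * f x) ^ 2 / f x := by
      field_simp
      ring
    have h0 : 0 ≤ (c x - A / F * f x) ^ 2 / f x := by positivity
    have := mul_le_mul_of_nonneg_left
      (show 2 * (A / F) * c x - (A / F) ^ 2 * f x ≤ c x ^ 2 / f x by linarith) (hw x)
    change 2 * (A / F) * (w x * c x) - (A / F) ^ 2 * (w x * f x) ≤ _
    linarith
  rw [integral_sub (h1.const_mul _) (h2.const_mul _), integral_const_mul, integral_const_mul,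
    ← hA, ← hF] at key
  have : A ^ 2 / F = 2 * (A / F) * A - (A / F) ^ 2 * F := by
    field_simp
    ring
  linarith

theorem aux_weak {d : ℕ} (K : Kernel (Euc d) (Euc d)) [IsMarkovKernel K]
    (hb : ∀ g : Euc d → ℝ, ContDiff ℝ 1 g → (∃ M : ℝ, ∀ y, ‖fderiv ℝ g y‖ ≤ M) →
      Differentiable ℝ (fun x => ∫ y, g y ∂(K x)))
    (g : Euc d → ℝ) (hg : Continuous g) (hgs : HasCompactSupport g) :
    Continuous (fun z => ∫ y, g y ∂(K z)) := by
  have huc : UniformContinuous g := hgs.uniformContinuous_of_continuous hg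
  apply continuous_of_uniform_approx_of_continuous
  intro u hu
  obtain ⟨ε, hε, hεu⟩ := Metric.mem_uniformity_dist.1 hu
  obtain ⟨r, hr, hrr⟩ := Metric.uniformContinuous_iff.mp huc (ε / 2) (half_pos hε)
  let φ : ContDiffBump (0 : Euc d) := ⟨r / 2, r, half_pos hr, half_lt_self hr⟩
  set h : Euc d → ℝ := MeasureTheory.convolution (φ.normed volume) g
    (ContinuousLinearMap.lsmul ℝ ℝ) volume with hh
  have h1 : ContDiff ℝ 1 h :=
    φ.hasCompactSupport_normed.contDiff_convolution_left _ (φ.contDiff_normed (n := 1))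
      hg.locallyIntegrable
  have h2 : HasCompactSupport h := φ.hasCompactSupport_normed.convolution _ hgs
  have h3 : ∀ a, dist (h a) (g a) ≤ ε / 2 := fun a =>
    φ.dist_normed_convolution_le hg.aestronglyMeasurable fun x hx => (hrr hx).le
  obtain ⟨M, hM⟩ := (h1.continuous_fderiv one_ne_zero).bounded_above_of_compact_support
    (h2.fderiv (𝕜 := ℝ))
  refine ⟨_, (hb h h1 ⟨M, hM⟩).continuous, fun z => hεu ?_⟩
  obtain ⟨Mg, hMg⟩ := hg.bounded_above_of_compact_support hgs
  obtain ⟨Mh, hMh⟩ := h1.continuous.bounded_above_of_compact_support h2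
  rw [Real.dist_eq, ← integral_sub (aux_bdd_s18 _ _ hg.measurable Mg hMg)
    (aux_bdd_s18 _ _ h1.continuous.measurable Mh hMh)]
  have := norm_integral_le_of_norm_le_const (μ := K z) (f := fun y => g y - h y) (C := ε / 2)
    (Eventually.of_forall fun y => by
      have := h3 y
      rw [dist_comm] at this
      exact this)
  simp at this
  linarith

section moll
variable {d : ℕ} (K : Kernel (Euc d) (Euc d)) [IsMarkovKernel K]

theorem aux_int_w (w : Euc d → ℝ) (hw : Continuous w) (hws : HasCompactSupport w) (x : Euc d)
    (h : Euc d × Euc d → ℝ) (hm : Measurable h) (M : ℝ) (hM : ∀ q, |h q| ≤ M) :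
    Integrable (fun q : Euc d × Euc d => w (x - q.1) * h q)
      ((volume : Measure (Euc d)).compProd K) := by
  have h1 : Integrable (fun z => w (x - z)) (volume : Measure (Euc d)) :=
    (hw.integrable_of_hasCompactSupport hws).comp_sub_left x
  have h2 := aux_int_fst volume K _ h1
  exact h2.mul_bdd (c := M) hm.aestronglyMeasurable (Eventually.of_forall hM)

theorem aux_moll_deriv (w : Euc d → ℝ) (hw : ContDiff ℝ 1 w) (hws : HasCompactSupport w)
    (f : Euc d × Euc d → ℝ) (hf : ContDiff ℝ 1 f) (M : ℝ) (hM : ∀ p, |f p| ≤ M)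
    (hM' : ∀ p, ‖fderiv ℝ f p‖ ≤ M) :
    (∀ x, HasFDerivAt
      (fun x => ∫ q, w (x - q.1) * f (x, q.2) ∂((volume : Measure (Euc d)).compProd K))
      (∫ q, (w (x - q.1) • ((fderiv ℝ f (x, q.2)).comp
          (ContinuousLinearMap.inl ℝ (Euc d) (Euc d))) + f (x, q.2) • fderiv ℝ w (x - q.1))
        ∂((volume : Measure (Euc d)).compProd K)) x) ∧
    ContDiff ℝ 1
      (fun x => ∫ q, w (x - q.1) * f (x, q.2) ∂((volume : Measure (Euc d)).compProd K)) := by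
  set F' : Euc d → Euc d × Euc d → (Euc d →L[ℝ] ℝ) := fun x q =>
    w (x - q.1) • ((fderiv ℝ f (x, q.2)).comp
      (ContinuousLinearMap.inl ℝ (Euc d) (Euc d))) + f (x, q.2) • fderiv ℝ w (x - q.1) with hF'
  have hfd : Continuous (fderiv ℝ f) := hf.continuous_fderiv one_ne_zero
  have hwd : Continuous (fderiv ℝ w) := hw.continuous_fderiv one_ne_zero
  have hwc := hw.continuous
  have hfc := hf.continuous
  obtain ⟨W, hW⟩ := hwc.bounded_above_of_compact_support hws
  obtain ⟨W', hW'⟩ := hwd.bounded_above_of_compact_support (hws.fderiv (𝕜 := ℝ))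
  obtain ⟨R, hR⟩ := hws.isBounded.subset_closedBall (0 : Euc d)
  have hM0 : 0 ≤ M := (abs_nonneg _).trans (hM 0)
  have hW0 : 0 ≤ W := (norm_nonneg _).trans (hW 0)
  have hW0' : 0 ≤ W' := (norm_nonneg _).trans (hW' 0)
  have hcont : Continuous (fun z : Euc d × (Euc d × Euc d) => F' z.1 z.2) := by
    simp only [hF']
    fun_prop
  have hbound : ∀ x₀ : Euc d, ∀ q : Euc d × Euc d, ∀ x ∈ Metric.ball x₀ 1,
      ‖F' x q‖ ≤ (Metric.closedBall x₀ (R + 1)).indicator (fun _ => W * M + M * W') q.1 := by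
    intro x₀ q x hx
    by_cases hq : q.1 ∈ Metric.closedBall x₀ (R + 1)
    · rw [Set.indicator_of_mem hq]
      refine (norm_add_le _ _).trans ?_
      rw [norm_smul, norm_smul]
      gcongr
      · exact hW _
      · refine (ContinuousLinearMap.opNorm_comp_le _ _).trans ?_
        have := ContinuousLinearMap.norm_inl_le_one ℝ (Euc d) (Euc d)
        calc _ ≤ M * 1 := by
              gcongr
              exact hM' _
          _ = M := mul_one M
      · exact hM _
      · exact hW' _
    · rw [Set.indicator_of_notMem hq]
      have hns : x - q.1 ∉ tsupport w := by
        intro hmem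
        apply hq
        have h1 := hR hmem
        rw [mem_closedBall_zero_iff] at h1
        rw [Metric.mem_closedBall, dist_eq_norm]
        rw [Metric.mem_ball, dist_eq_norm] at hx
        calc ‖q.1 - x₀‖ = ‖(x - x₀) - (x - q.1)‖ := by congr 1; abel
          _ ≤ ‖x - x₀‖ + ‖x - q.1‖ := norm_sub_le _ _
          _ ≤ R + 1 := by linarith
      have e1 : w (x - q.1) = 0 := image_eq_zero_of_notMem_tsupport hns
      have e2 : fderiv ℝ w (x - q.1) = 0 := fderiv_of_notMem_tsupport ℝ hns
      simp [hF', e1, e2]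
  have hbi : ∀ x₀ : Euc d, Integrable (fun q : Euc d × Euc d =>
      (Metric.closedBall x₀ (R + 1)).indicator (fun _ => W * M + M * W') q.1)
      ((volume : Measure (Euc d)).compProd K) := by
    intro x₀
    apply aux_int_fst volume K
    rw [integrable_indicator_iff measurableSet_closedBall]
    exact integrableOn_const measure_closedBall_lt_top.ne
  have hder : ∀ x, HasFDerivAt
      (fun x => ∫ q, w (x - q.1) * f (x, q.2) ∂((volume : Measure (Euc d)).compProd K))
      (∫ q, F' x q ∂((volume : Measure (Euc d)).compProd K)) x := by
    intro x₀
    refine hasFDerivAt_integral_of_dominated_of_fderiv_le (Metric.ball_mem_nhds x₀ one_pos)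
      (Eventually.of_forall fun x => ?_) ?_ ?_
      (Eventually.of_forall fun q => hbound x₀ q) (hbi x₀)
      (Eventually.of_forall fun q x hx => ?_)
    · exact Continuous.aestronglyMeasurable (by fun_prop)
    · exact aux_int_w K w hwc hws x₀ (fun q => f (x₀, q.2)) (by fun_prop) M (fun q => hM _)
    · exact Continuous.aestronglyMeasurable (hcont.comp (by fun_prop : Continuous fun q => (x₀, q)))
    · have h1 : HasFDerivAt (fun x => w (x - q.1)) (fderiv ℝ w (x - q.1)) x := by
        have := (hw.differentiable one_ne_zero (x - q.1)).hasFDerivAt.comp x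
          ((hasFDerivAt_id x).sub_const q.1)
        rw [ContinuousLinearMap.comp_id] at this
        exact this
      exact h1.mul (aux_grad1 f hf x q.2)
  refine ⟨hder, ?_⟩
  rw [contDiff_one_iff_fderiv]
  refine ⟨fun x => (hder x).differentiableAt, ?_⟩
  have : fderiv ℝ (fun x => ∫ q, w (x - q.1) * f (x, q.2)
      ∂((volume : Measure (Euc d)).compProd K)) =
      fun x => ∫ q, F' x q ∂((volume : Measure (Euc d)).compProd K) :=
    funext fun x => (hder x).fderiv
  rw [this, continuous_iff_continuousAt]
  intro x₀
  refine continuousAt_of_dominated (Eventually.of_forall fun x => ?_)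
    ?_ (hbi x₀) (Eventually.of_forall fun q => ?_)
  · exact Continuous.aestronglyMeasurable (hcont.comp (by fun_prop : Continuous fun q => (x, q)))
  · filter_upwards [Metric.ball_mem_nhds x₀ one_pos] with x hx
    exact Eventually.of_forall fun q => hbound x₀ q x hx
  · exact (hcont.comp (by fun_prop : Continuous fun x => (x, q))).continuousAt

theorem aux_moll_bound (s : ℝ) (hs : 0 ≤ s)
    (hb : ∀ g : Euc d → ℝ, ContDiff ℝ 1 g → (∃ M : ℝ, ∀ y, ‖fderiv ℝ g y‖ ≤ M) →
      Differentiable ℝ (fun x => ∫ y, g y ∂(K x)) ∧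
      ∀ x : Euc d, ‖fderiv ℝ (fun x' => ∫ y, g y ∂(K x')) x‖ ≤
        s * ∫ y, ‖fderiv ℝ g y‖ ∂(K x))
    (w : Euc d → ℝ) (hw : ContDiff ℝ 1 w) (hws : HasCompactSupport w) (hw0 : ∀ z, 0 ≤ w z)
    (f : Euc d × Euc d → ℝ) (hf : ContDiff ℝ 1 f) (M : ℝ) (hM : ∀ p, |f p| ≤ M)
    (hM' : ∀ p, ‖fderiv ℝ f p‖ ≤ M) (x : Euc d) :
    ‖∫ q, (w (x - q.1) • ((fderiv ℝ f (x, q.2)).comp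
          (ContinuousLinearMap.inl ℝ (Euc d) (Euc d))) + f (x, q.2) • fderiv ℝ w (x - q.1))
        ∂((volume : Measure (Euc d)).compProd K)‖ ≤
    ∫ q, w (x - q.1) * (‖(fderiv ℝ f (x, q.2)).comp
        (ContinuousLinearMap.inl ℝ (Euc d) (Euc d))‖ +
        s * ‖(fderiv ℝ f (x, q.2)).comp (ContinuousLinearMap.inr ℝ (Euc d) (Euc d))‖)
      ∂((volume : Measure (Euc d)).compProd K) := by
  have hfd : Continuous (fderiv ℝ f) := hf.continuous_fderiv one_ne_zero
  have hwd : Continuous (fderiv ℝ w) := hw.continuous_fderiv one_ne_zero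
  have hwc := hw.continuous
  have hfc := hf.continuous
  have hM0 : 0 ≤ M := (abs_nonneg _).trans (hM 0)
  set a : Euc d → (Euc d →L[ℝ] ℝ) := fun y => (fderiv ℝ f (x, y)).comp
        (ContinuousLinearMap.inl ℝ (Euc d) (Euc d)) with ha
  set b : Euc d → (Euc d →L[ℝ] ℝ) := fun y => (fderiv ℝ f (x, y)).comp
        (ContinuousLinearMap.inr ℝ (Euc d) (Euc d)) with hb'
  have hac : Continuous a := by simp only [ha]; fun_prop
  have hbc : Continuous b := by simp only [hb']; fun_prop
  have haM : ∀ y, ‖a y‖ ≤ M := fun y => by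
    refine (ContinuousLinearMap.opNorm_comp_le _ _).trans ?_
    have := ContinuousLinearMap.norm_inl_le_one ℝ (Euc d) (Euc d)
    calc _ ≤ M * 1 := by
          gcongr
          exact hM' _
      _ = M := mul_one M
  have hbM : ∀ y, ‖b y‖ ≤ M := fun y => by
    refine (ContinuousLinearMap.opNorm_comp_le _ _).trans ?_
    have := ContinuousLinearMap.norm_inr_le_one ℝ (Euc d) (Euc d)
    calc _ ≤ M * 1 := by
          gcongr
          exact hM' _
      _ = M := mul_one M
  set ν := (volume : Measure (Euc d)).compProd K with hν
  -- integrability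
  have hwx : Integrable (fun z => w (x - z)) (volume : Measure (Euc d)) :=
    (hwc.integrable_of_hasCompactSupport hws).comp_sub_left x
  have hwx2 := aux_int_fst volume K _ hwx
  have hdwx : Integrable (fun z => ‖fderiv ℝ w (x - z)‖) (volume : Measure (Euc d)) :=
    ((hwd.integrable_of_hasCompactSupport (hws.fderiv (𝕜 := ℝ))).comp_sub_left x).norm
  have hdwx2 := aux_int_fst volume K _ hdwx
  have i1 : Integrable (fun q : Euc d × Euc d => w (x - q.1) • a q.2) ν := by
    refine Integrable.mono' (hwx2.mul_const M)
      (Continuous.aestronglyMeasurable (by fun_prop)) (Eventually.of_forall fun q => ?_)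
    rw [norm_smul, Real.norm_of_nonneg (hw0 _)]
    exact mul_le_mul_of_nonneg_left (haM _) (hw0 _)
  have i2 : Integrable (fun q : Euc d × Euc d => f (x, q.2) • fderiv ℝ w (x - q.1)) ν := by
    refine Integrable.mono' (hdwx2.const_mul M)
      (Continuous.aestronglyMeasurable (by fun_prop)) (Eventually.of_forall fun q => ?_)
    rw [norm_smul]
    exact mul_le_mul_of_nonneg_right (hM _) (norm_nonneg _)
  have i3 : Integrable (fun q : Euc d × Euc d => w (x - q.1) * ‖a q.2‖) ν :=
    aux_int_w K w hwc hws x (fun q => ‖a q.2‖) (by fun_prop) M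
      (fun q => by rw [abs_norm]; exact haM _)
  have i4 : Integrable (fun q : Euc d × Euc d => w (x - q.1) * (s * ‖b q.2‖)) ν :=
    aux_int_w K w hwc hws x (fun q => s * ‖b q.2‖) (by fun_prop) (s * M)
      (fun q => by
        rw [abs_of_nonneg (by positivity)]
        exact mul_le_mul_of_nonneg_left (hbM _) hs)
  rw [integral_add i1 i2]
  simp_rw [mul_add]
  rw [integral_add i3 i4]
  refine (norm_add_le _ _).trans (add_le_add ?_ ?_)
  · refine (norm_integral_le_integral_norm _).trans (le_of_eq ?_)
    congr 1
    ext q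
    rw [norm_smul, Real.norm_of_nonneg (hw0 _)]
  · have hg : ContDiff ℝ 1 (fun y => f (x, y)) := by fun_prop
    have hgd : ∀ y, fderiv ℝ (fun y => f (x, y)) y = b y := fun y => (aux_grad2 f hf x y).fderiv
    obtain ⟨hFd, hFb⟩ := hb (fun y => f (x, y)) hg ⟨M, fun y => by rw [hgd]; exact hbM y⟩
    simp_rw [hgd] at hFb
    set Fx : Euc d → ℝ := fun z => ∫ y, f (x, y) ∂(K z) with hFx
    have hFxM : ∀ z, |Fx z| ≤ M := fun z => by
      have := norm_integral_le_of_norm_le_const (μ := K z) (f := fun y => f (x, y)) (C := M)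
        (Eventually.of_forall fun y => hM _)
      simpa using this
    have hBM : ∀ z, ∫ y, ‖b y‖ ∂(K z) ≤ M := fun z => by
      have := norm_integral_le_of_norm_le_const (μ := K z) (f := fun y => ‖b y‖) (C := M)
        (Eventually.of_forall fun y => by rw [norm_norm]; exact hbM _)
      simp only [probReal_univ, mul_one] at this
      exact (le_abs_self _).trans this
    refine ContinuousLinearMap.opNorm_le_bound _
      (integral_nonneg fun q => mul_nonneg (hw0 _) (mul_nonneg hs (norm_nonneg _))) fun v => ?_
    rw [ContinuousLinearMap.integral_apply i2]
    have hs1 : Integrable (fun q : Euc d × Euc d => f (x, q.2) * fderiv ℝ w (x - q.1) v) ν :=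
      i2.apply_continuousLinearMap v
    have hs2 : ∫ q, (f (x, q.2) • fderiv ℝ w (x - q.1)) v ∂ν =
        ∫ z, Fx z * fderiv ℝ w (x - z) v := by
      have := Measure.integral_compProd hs1
      simp only [integral_mul_const] at this
      exact this
    rw [hs2, Measure.integral_compProd i4]
    simp only [integral_const_mul]
    have hu : ∀ z, HasFDerivAt (fun z => w (x - z)) (-fderiv ℝ w (x - z)) z := fun z => by
      have := (hw.differentiable one_ne_zero (x - z)).hasFDerivAt.comp z
          ((hasFDerivAt_id z).const_sub x)
      rw [ContinuousLinearMap.comp_neg, ContinuousLinearMap.comp_id] at this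
      exact this
    have hFfm : Measurable (fun z => fderiv ℝ Fx z v) := measurable_fderiv_apply_const ℝ Fx v
    have hfle : ∀ z, |fderiv ℝ Fx z v| ≤ (s * ∫ y, ‖b y‖ ∂(K z)) * ‖v‖ := fun z =>
      ((fderiv ℝ Fx z).le_opNorm v).trans (mul_le_mul_of_nonneg_right (hFb z) (norm_nonneg _))
    have j1 : Integrable (fun z => fderiv ℝ Fx z v * w (x - z)) volume := by
      refine hwx.bdd_mul (c := s * M * ‖v‖) hFfm.aestronglyMeasurable
        (Eventually.of_forall fun z => (hfle z).trans ?_)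
      gcongr
      exact hBM z
    have hdv : Integrable (fun z => fderiv ℝ w (x - z) v) (volume : Measure (Euc d)) :=
      ((hwd.integrable_of_hasCompactSupport
        (hws.fderiv (𝕜 := ℝ))).comp_sub_left x).apply_continuousLinearMap v
    have j2 : Integrable (fun z => Fx z * fderiv ℝ (fun z => w (x - z)) z v) volume := by
      simp_rw [(hu _).fderiv]
      refine Integrable.bdd_mul (c := M) hdv.neg hFd.continuous.aestronglyMeasurable
        (Eventually.of_forall hFxM)
    have j3 : Integrable (fun z => Fx z * w (x - z)) volume :=
      hwx.bdd_mul (c := M) hFd.continuous.aestronglyMeasurable (Eventually.of_forall hFxM)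
    have ibp := integral_mul_fderiv_eq_neg_fderiv_mul_of_integrable j1 j2 j3
      (fun z _ => hFd z) (fun z _ => (hu z).differentiableAt)
    simp_rw [(hu _).fderiv] at ibp
    have e : ∫ z, Fx z * fderiv ℝ w (x - z) v = ∫ z, fderiv ℝ Fx z v * w (x - z) := by
      have : ∫ z, Fx z * (-fderiv ℝ w (x - z)) v = - ∫ z, Fx z * fderiv ℝ w (x - z) v := by
        rw [← integral_neg]
        congr 1
        ext z
        simp
      linarith
    rw [e, ← integral_mul_const]
    have j4 := aux_int_compProd volume K _ i4
    simp only [integral_const_mul] at j4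
    refine norm_integral_le_of_norm_le (j4.mul_const _) (Eventually.of_forall fun z => ?_)
    rw [norm_mul, Real.norm_of_nonneg (hw0 _), mul_comm, mul_assoc]
    exact mul_le_mul_of_nonneg_left (hfle z) (hw0 _)

end moll

section core
variable {d : ℕ} (K : Kernel (Euc d) (Euc d)) [IsMarkovKernel K]

theorem aux_moll_val (w : Euc d → ℝ) (hw : Continuous w) (hws : HasCompactSupport w) (x : Euc d)
    (h : Euc d → ℝ) (hm : Measurable h) (M : ℝ) (hM : ∀ q, |h q| ≤ M) :
    ∫ q, w (x - q.1) * h q.2 ∂((volume : Measure (Euc d)).compProd K) =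
      ∫ z, w (x - z) * ∫ y, h y ∂(K z) := by
  rw [Measure.integral_compProd (aux_int_w K w hw hws x (fun q => h q.2) (by fun_prop) M
    (fun q => hM _))]
  simp only [integral_const_mul]

theorem aux_moll_le (w : Euc d → ℝ) (hw : Continuous w) (hws : HasCompactSupport w)
    (hw0 : ∀ z, 0 ≤ w z) (hw1 : ∫ z, w z = 1) (x : Euc d)
    (h : Euc d → ℝ) (hm : Measurable h) (m M : ℝ) (hl : ∀ q, m ≤ h q) (hu : ∀ q, h q ≤ M) :
    m ≤ ∫ q, w (x - q.1) * h q.2 ∂((volume : Measure (Euc d)).compProd K) ∧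
    ∫ q, w (x - q.1) * h q.2 ∂((volume : Measure (Euc d)).compProd K) ≤ M := by
  have hc : ∀ c : ℝ, ∫ q : Euc d × Euc d, w (x - q.1) * c
      ∂((volume : Measure (Euc d)).compProd K) = c := fun c => by
    rw [aux_moll_val K w hw hws x (fun _ => c) measurable_const |c| (fun _ => le_rfl)]
    simp only [integral_const, probReal_univ, one_smul]
    rw [integral_mul_const, integral_sub_left_eq_self w volume x, hw1, one_mul]
  have hi : ∀ c : ℝ, Integrable (fun q : Euc d × Euc d => w (x - q.1) * c)
      ((volume : Measure (Euc d)).compProd K) := fun c =>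
    aux_int_w K w hw hws x (fun _ => c) measurable_const |c| (fun _ => le_rfl)
  have hh := aux_int_w K w hw hws x (fun q => h q.2) (by fun_prop) (max |m| |M|)
    (fun q => abs_le_max_abs_abs (hl _) (hu _))
  constructor
  · rw [← hc m]
    exact integral_mono (hi m) hh fun q => mul_le_mul_of_nonneg_left (hl _) (hw0 _)
  · conv_rhs => rw [← hc M]
    exact integral_mono hh (hi M) fun q => mul_le_mul_of_nonneg_left (hu _) (hw0 _)

theorem aux_moll_tendsto (φ : ℕ → ContDiffBump (0 : Euc d))
    (hφ : Tendsto (fun n => (φ n).rOut) atTop (𝓝 0)) (x : Euc d)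
    (h : Euc d → ℝ) (hm : Measurable h) (M : ℝ) (hM : ∀ q, |h q| ≤ M)
    (hc : Continuous (fun z => ∫ y, h y ∂(K z))) :
    Tendsto (fun n => ∫ q, (φ n).normed volume (x - q.1) * h q.2
      ∂((volume : Measure (Euc d)).compProd K)) atTop (𝓝 (∫ y, h y ∂(K x))) := by
  have := ContDiffBump.convolution_tendsto_right_of_continuous (μ := volume) hφ hc x
  refine this.congr fun n => ?_
  rw [convolution_lsmul_swap, aux_moll_val K _ (φ n).continuous_normed
    (φ n).hasCompactSupport_normed x h hm M hM]
  rfl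

theorem aux_core_mu (μ : Measure (Euc d)) [IsProbabilityMeasure μ] (Cμ : ℝ) (hC : 0 ≤ Cμ)
    (hμ : HasLSI μ Cμ) (s : ℝ) (hs : 0 ≤ s)
    (hb : ∀ g : Euc d → ℝ, ContDiff ℝ 1 g → (∃ M : ℝ, ∀ y, ‖fderiv ℝ g y‖ ≤ M) →
      Differentiable ℝ (fun x => ∫ y, g y ∂(K x)) ∧
      ∀ x : Euc d, ‖fderiv ℝ (fun x' => ∫ y, g y ∂(K x')) x‖ ≤
        s * ∫ y, ‖fderiv ℝ g y‖ ∂(K x))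
    (f : Euc d × Euc d → ℝ) (hf : ContDiff ℝ 1 f) (δ M : ℝ) (hδ : 0 < δ)
    (hl : ∀ p, δ ≤ f p) (hu : ∀ p, f p ≤ M)
    (hM' : ∀ p, ‖fderiv ℝ f p‖ ≤ M) (hsupp : HasCompactSupport (fderiv ℝ f)) :
    (∫ x, (∫ y, f (x, y) ∂(K x)) * Real.log (∫ y, f (x, y) ∂(K x)) ∂μ) -
      (∫ x, (∫ y, f (x, y) ∂(K x)) ∂μ) * Real.log (∫ x, (∫ y, f (x, y) ∂(K x)) ∂μ) ≤
    Cμ / 2 * ∫ x, ∫ y, (2 * ‖(fderiv ℝ f (x, y)).comp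
        (ContinuousLinearMap.inl ℝ (Euc d) (Euc d))‖ ^ 2 +
        2 * s ^ 2 * ‖(fderiv ℝ f (x, y)).comp
          (ContinuousLinearMap.inr ℝ (Euc d) (Euc d))‖ ^ 2) / f (x, y) ∂(K x) ∂μ := by
  have hfd : Continuous (fderiv ℝ f) := hf.continuous_fderiv one_ne_zero
  have hfc := hf.continuous
  have hfpos : ∀ p, 0 < f p := fun p => hδ.trans_le (hl p)
  have hfne : ∀ p, f p ≠ 0 := fun p => (hfpos p).ne'
  have habs : ∀ p, |f p| ≤ M := fun p => by rw [abs_of_pos (hfpos p)]; exact hu p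
  set a : Euc d × Euc d → ℝ := fun p => ‖(fderiv ℝ f p).comp
        (ContinuousLinearMap.inl ℝ (Euc d) (Euc d))‖ with ha
  set b : Euc d × Euc d → ℝ := fun p => ‖(fderiv ℝ f p).comp
        (ContinuousLinearMap.inr ℝ (Euc d) (Euc d))‖ with hb'
  have hac : Continuous a := by simp only [ha]; fun_prop
  have hbc : Continuous b := by simp only [hb']; fun_prop
  have ha0 : ∀ p, 0 ≤ a p := fun p => norm_nonneg _
  have hb0 : ∀ p, 0 ≤ b p := fun p => norm_nonneg _
  set G : Euc d × Euc d → ℝ := fun p => (2 * a p ^ 2 + 2 * s ^ 2 * b p ^ 2) / f p with hG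
  set c : Euc d × Euc d → ℝ := fun p => a p + s * b p with hc
  have hGc : Continuous G := by
    simp only [hG]
    exact Continuous.div (by fun_prop) hfc hfne
  have hcc : Continuous c := by simp only [hc]; fun_prop
  have hG0 : ∀ p, 0 ≤ G p := fun p => div_nonneg (by positivity) (hfpos p).le
  have hGs : HasCompactSupport G := by
    refine hsupp.mono fun p hp => ?_
    rw [Function.mem_support] at hp ⊢
    intro h0
    apply hp
    simp [hG, ha, hb', h0]
  have hcs : HasCompactSupport c := by
    refine hsupp.mono fun p hp => ?_
    rw [Function.mem_support] at hp ⊢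
    intro h0
    apply hp
    simp [hc, ha, hb', h0]
  obtain ⟨BG, hBG⟩ := hGc.bounded_above_of_compact_support hGs
  obtain ⟨Bc, hBc⟩ := hcc.bounded_above_of_compact_support hcs
  have hGle : ∀ p, G p ≤ BG := fun p => (le_abs_self _).trans (hBG p)
  -- weak continuity
  have hHc : ∀ x, Continuous (fun z => ∫ y, G (x, y) ∂(K z)) := fun x => by
    apply aux_weak K (fun g h1 h2 => (hb g h1 h2).1) (fun y => G (x, y)) (by fun_prop)
    refine HasCompactSupport.intro (hGs.image continuous_snd) (fun y hy => ?_)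
    by_contra hne
    exact hy ⟨(x, y), subset_tsupport _ hne, rfl⟩
  have hFc : ∀ x, Continuous (fun z => ∫ y, f (x, y) ∂(K z)) := fun x => by
    refine (hb (fun y => f (x, y)) (by fun_prop) ⟨M, fun y => ?_⟩).1.continuous
    rw [(aux_grad2 f hf x y).fderiv]
    refine (ContinuousLinearMap.opNorm_comp_le _ _).trans ?_
    have := ContinuousLinearMap.norm_inr_le_one ℝ (Euc d) (Euc d)
    calc _ ≤ M * 1 := by
          gcongr
          · exact hδ.le.trans ((hl 0).trans (hu 0))
          · exact hM' _
      _ = M := mul_one M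
  -- mollifiers
  let φ : ℕ → ContDiffBump (0 : Euc d) := fun n =>
    ⟨1 / ((n : ℝ) + 1) / 2, 1 / ((n : ℝ) + 1), by positivity, half_lt_self (by positivity)⟩
  have hφ : Tendsto (fun n => (φ n).rOut) atTop (𝓝 0) := tendsto_one_div_add_atTop_nhds_zero_nat
  set ν := (volume : Measure (Euc d)).compProd K with hν
  set w : ℕ → Euc d → ℝ := fun n => (φ n).normed volume with hwdef
  have hw1 : ∀ n, ContDiff ℝ 1 (w n) := fun n => (φ n).contDiff_normed (n := 1)
  have hws : ∀ n, HasCompactSupport (w n) := fun n => (φ n).hasCompactSupport_normed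
  have hw0 : ∀ n z, 0 ≤ w n z := fun n z => (φ n).nonneg_normed z
  have hwi : ∀ n, ∫ z, w n z = 1 := fun n => (φ n).integral_normed
  set fe : ℕ → Euc d → ℝ := fun n x => ∫ q, w n (x - q.1) * f (x, q.2) ∂ν with hfe
  set Q : ℕ → Euc d → ℝ := fun n x => ∫ q, w n (x - q.1) * G (x, q.2) ∂ν with hQ
  have hfeb : ∀ n x, δ ≤ fe n x ∧ fe n x ≤ M := fun n x =>
    aux_moll_le K (w n) (hw1 n).continuous (hws n) (hw0 n) (hwi n) x (fun y => f (x, y))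
      (by fun_prop) δ M (fun _ => hl _) (fun _ => hu _)
  have hQb : ∀ n x, 0 ≤ Q n x ∧ Q n x ≤ BG := fun n x =>
    aux_moll_le K (w n) (hw1 n).continuous (hws n) (hw0 n) (hwi n) x (fun y => G (x, y))
      (by fun_prop) 0 BG (fun _ => hG0 _) (fun _ => hGle _)
  have hfet : ∀ x, Tendsto (fun n => fe n x) atTop (𝓝 (∫ y, f (x, y) ∂(K x))) := fun x =>
    aux_moll_tendsto K φ hφ x (fun y => f (x, y)) (by fun_prop) M (fun _ => habs _) (hFc x)
  have hQt : ∀ x, Tendsto (fun n => Q n x) atTop (𝓝 (∫ y, G (x, y) ∂(K x))) := fun x =>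
    aux_moll_tendsto K φ hφ x (fun y => G (x, y)) (by fun_prop) BG (fun _ => hBG _) (hHc x)
  have hder := fun n => aux_moll_deriv K (w n) (hw1 n) (hws n) f hf M habs hM'
  have hfe1 : ∀ n, ContDiff ℝ 1 (fe n) := fun n => (hder n).2
  have hfepos : ∀ n x, 0 < fe n x := fun n x => hδ.trans_le (hfeb n x).1
  have hgrad : ∀ n x, ‖gradient (fe n) x‖ ^ 2 / fe n x ≤ Q n x := fun n x => by
    have hwc := (hw1 n).continuous
    have h1 : ‖gradient (fe n) x‖ ≤ ∫ q, w n (x - q.1) * c (x, q.2) ∂ν := by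
      rw [aux_norm_gradient, ((hder n).1 x).fderiv]
      exact aux_moll_bound K s hs hb (w n) (hw1 n) (hws n) (hw0 n) f hf M habs hM' x
    have hq : ∀ p, c p ^ 2 / f p ≤ G p := fun p => by
      simp only [hG, hc]
      refine div_le_div_of_nonneg_right ?_ (hfpos p).le
      nlinarith [sq_nonneg (a p - s * b p)]
    have hqm : Continuous (fun p => c p ^ 2 / f p) := (hcc.pow 2).div hfc hfne
    have hq0 : ∀ p, 0 ≤ c p ^ 2 / f p := fun p => div_nonneg (sq_nonneg _) (hfpos p).le
    have i3 := aux_int_w K (w n) hwc (hws n) x (fun q => c (x, q.2) ^ 2 / f (x, q.2))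
      (hqm.comp (by fun_prop : Continuous fun q : Euc d × Euc d => (x, q.2))).measurable BG
      (fun q => by rw [abs_of_nonneg (hq0 _)]; exact (hq _).trans (hGle _))
    have i4 := aux_int_w K (w n) hwc (hws n) x (fun q => G (x, q.2)) (by fun_prop) BG
      (fun q => hBG _)
    calc ‖gradient (fe n) x‖ ^ 2 / fe n x
        ≤ (∫ q, w n (x - q.1) * c (x, q.2) ∂ν) ^ 2 / fe n x := by
          have := (hfepos n x).le
          gcongr
      _ ≤ ∫ q, w n (x - q.1) * (c (x, q.2) ^ 2 / f (x, q.2)) ∂ν :=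
          aux_cs ν (fun q => w n (x - q.1)) (fun q => f (x, q.2)) (fun q => c (x, q.2))
            (fun q => hw0 n _) (fun q => hfpos _)
            (aux_int_w K (w n) hwc (hws n) x (fun q => c (x, q.2)) (by fun_prop) Bc
              (fun q => hBc _))
            (aux_int_w K (w n) hwc (hws n) x (fun q => f (x, q.2)) (by fun_prop) M
              (fun q => habs _)) i3 (hfepos n x)
      _ ≤ Q n x := integral_mono i3 i4 fun q => mul_le_mul_of_nonneg_left (hq _) (hw0 n _)
  have hQm : ∀ n, StronglyMeasurable (Q n) := fun n => by
    have hwc := (hw1 n).continuous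
    have : Continuous (fun z : Euc d × (Euc d × Euc d) => w n (z.1 - z.2.1) * G (z.1, z.2.2)) := by
      fun_prop
    exact this.stronglyMeasurable.integral_prod_right
  have hQi : ∀ n, Integrable (Q n) μ := fun n =>
    aux_bdd_s18 μ (Q n) (hQm n).measurable BG fun x => by
      rw [abs_of_nonneg (hQb n x).1]; exact (hQb n x).2
  have hgi : ∀ n, Integrable (fun x => ‖gradient (fe n) x‖ ^ 2 / fe n x) μ := fun n => by
    have hgc : Continuous (fun x => ‖gradient (fe n) x‖ ^ 2 / fe n x) := by
      simp_rw [aux_norm_gradient]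
      exact (((hfe1 n).continuous_fderiv one_ne_zero).norm.pow 2).div (hfe1 n).continuous
        (fun x => (hfepos n x).ne')
    refine (hQi n).mono' hgc.aestronglyMeasurable (Eventually.of_forall fun x => ?_)
    rw [Real.norm_of_nonneg (div_nonneg (sq_nonneg _) (hfepos n x).le)]
    exact hgrad n x
  have main : ∀ n, (∫ x, fe n x * Real.log (fe n x) ∂μ) -
      (∫ x, fe n x ∂μ) * Real.log (∫ x, fe n x ∂μ) ≤ Cμ / 2 * ∫ x, Q n x ∂μ := fun n =>
    (hμ (fe n) (hfepos n) (hfe1 n) (hgi n)).trans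
      (mul_le_mul_of_nonneg_left (integral_mono (hgi n) (hQi n) (hgrad n)) (by positivity))
  -- limits
  obtain ⟨L, hL⟩ := (isCompact_Icc (a := δ) (b := M)).exists_bound_of_continuousOn
    Real.continuous_mul_log.continuousOn
  have t1 : Tendsto (fun n => ∫ x, fe n x ∂μ) atTop (𝓝 (∫ x, ∫ y, f (x, y) ∂(K x) ∂μ)) := by
    refine tendsto_integral_of_dominated_convergence (fun _ => M)
      (fun n => (hfe1 n).continuous.aestronglyMeasurable) (integrable_const _)
      (fun n => Eventually.of_forall fun x => ?_) (Eventually.of_forall hfet)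
    rw [Real.norm_of_nonneg (hfepos n x).le]
    exact (hfeb n x).2
  have t2 : Tendsto (fun n => ∫ x, fe n x * Real.log (fe n x) ∂μ) atTop
      (𝓝 (∫ x, (∫ y, f (x, y) ∂(K x)) * Real.log (∫ y, f (x, y) ∂(K x)) ∂μ)) := by
    refine tendsto_integral_of_dominated_convergence (fun _ => L)
      (fun n => (Real.continuous_mul_log.comp (hfe1 n).continuous).aestronglyMeasurable)
      (integrable_const _) (fun n => Eventually.of_forall fun x => hL _ (hfeb n x))
      (Eventually.of_forall fun x => (Real.continuous_mul_log.tendsto _).comp (hfet x))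
  have t3 : Tendsto (fun n => ∫ x, Q n x ∂μ) atTop (𝓝 (∫ x, ∫ y, G (x, y) ∂(K x) ∂μ)) := by
    refine tendsto_integral_of_dominated_convergence (fun _ => BG)
      (fun n => (hQm n).aestronglyMeasurable) (integrable_const _)
      (fun n => Eventually.of_forall fun x => ?_) (Eventually.of_forall hQt)
    rw [Real.norm_of_nonneg (hQb n x).1]
    exact (hQb n x).2
  exact le_of_tendsto_of_tendsto' (t2.sub ((Real.continuous_mul_log.tendsto _).comp t1))
    (t3.const_mul _) main

end core

section fin

theorem aux_core_pi {d : ℕ} (K : Kernel (Euc d) (Euc d)) [IsMarkovKernel K]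
    (μ : Measure (Euc d)) [IsProbabilityMeasure μ] (Cμ Ct : ℝ) (hC : 0 ≤ Cμ)
    (hμ : HasLSI μ Cμ) (s : ℝ) (hs : 0 ≤ s)
    (ha : ∀ (x : Euc d) (g : Euc d → ℝ), (∀ y, 0 < g y) → ContDiff ℝ 1 g →
      Integrable (fun y => ‖gradient g y‖^2 / g y) (K x) →
      (∫ y, g y * Real.log (g y) ∂(K x)) -
          (∫ y, g y ∂(K x)) * Real.log (∫ y, g y ∂(K x)) ≤
        Ct/2 * ∫ y, ‖gradient g y‖^2 / g y ∂(K x))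
    (hb : ∀ g : Euc d → ℝ, ContDiff ℝ 1 g → (∃ M : ℝ, ∀ y, ‖fderiv ℝ g y‖ ≤ M) →
      Differentiable ℝ (fun x => ∫ y, g y ∂(K x)) ∧
      ∀ x : Euc d, ‖fderiv ℝ (fun x' => ∫ y, g y ∂(K x')) x‖ ≤
        s * ∫ y, ‖fderiv ℝ g y‖ ∂(K x))
    (f : Euc d × Euc d → ℝ) (hf : ContDiff ℝ 1 f) (δ M : ℝ) (hδ : 0 < δ)
    (hl : ∀ p, δ ≤ f p) (hu : ∀ p, f p ≤ M)
    (hM' : ∀ p, ‖fderiv ℝ f p‖ ≤ M) (hsupp : HasCompactSupport (fderiv ℝ f)) :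
    (∫ p, f p * Real.log (f p) ∂(μ.compProd K)) -
      (∫ p, f p ∂(μ.compProd K)) * Real.log (∫ p, f p ∂(μ.compProd K)) ≤
    (max (2*Cμ) (2*Cμ*s^2 + Ct)) / 2 * ∫ p, (‖(fderiv ℝ f p).comp
        (ContinuousLinearMap.inl ℝ (Euc d) (Euc d))‖ ^ 2 +
        ‖(fderiv ℝ f p).comp
          (ContinuousLinearMap.inr ℝ (Euc d) (Euc d))‖ ^ 2) / f p ∂(μ.compProd K) := by
  have hmu := aux_core_mu K μ Cμ hC hμ s hs hb f hf δ M hδ hl hu hM' hsupp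
  have hfd : Continuous (fderiv ℝ f) := hf.continuous_fderiv one_ne_zero
  have hfc := hf.continuous
  have hfpos : ∀ p, 0 < f p := fun p => hδ.trans_le (hl p)
  have hfne : ∀ p, f p ≠ 0 := fun p => (hfpos p).ne'
  have habs : ∀ p, |f p| ≤ M := fun p => by rw [abs_of_pos (hfpos p)]; exact hu p
  set a : Euc d × Euc d → ℝ := fun p => ‖(fderiv ℝ f p).comp
        (ContinuousLinearMap.inl ℝ (Euc d) (Euc d))‖ with ha'
  set b : Euc d × Euc d → ℝ := fun p => ‖(fderiv ℝ f p).comp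
        (ContinuousLinearMap.inr ℝ (Euc d) (Euc d))‖ with hb'
  have hac : Continuous a := by simp only [ha']; fun_prop
  have hbc : Continuous b := by simp only [hb']; fun_prop
  have cs : ∀ h : Euc d × Euc d → ℝ, Continuous h → (∀ p, fderiv ℝ f p = 0 → h p = 0) →
      ∃ B, ∀ p, |h p| ≤ B := fun h hc h0 => by
    refine hc.bounded_above_of_compact_support (hsupp.mono fun p hp => ?_)
    rw [Function.mem_support] at hp ⊢
    exact fun h1 => hp (h0 p h1)
  have hA : Continuous (fun p => a p ^ 2 / f p) := Continuous.div (by fun_prop) hfc hfne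
  have hB : Continuous (fun p => b p ^ 2 / f p) := Continuous.div (by fun_prop) hfc hfne
  obtain ⟨BA, hBA⟩ := cs _ hA (fun p h0 => by simp [ha', h0])
  obtain ⟨BB, hBB⟩ := cs _ hB (fun p h0 => by simp [hb', h0])
  have iA : Integrable (fun p => a p ^ 2 / f p) (μ.compProd K) :=
    aux_bdd_s18 _ _ hA.measurable BA hBA
  have iB : Integrable (fun p => b p ^ 2 / f p) (μ.compProd K) :=
    aux_bdd_s18 _ _ hB.measurable BB hBB
  obtain ⟨L, hL⟩ := (isCompact_Icc (a := δ) (b := M)).exists_bound_of_continuousOn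
    Real.continuous_mul_log.continuousOn
  have ifl : Integrable (fun p => f p * Real.log (f p)) (μ.compProd K) :=
    aux_bdd_s18 _ _ (Real.continuous_mul_log.comp hfc).measurable L fun p => hL _ ⟨hl p, hu p⟩
  have iff' : Integrable f (μ.compProd K) := aux_bdd_s18 _ _ hfc.measurable M habs
  have if0 := aux_int_compProd μ K _ iff'
  have hf0b : ∀ x, δ ≤ ∫ y, f (x, y) ∂(K x) ∧ ∫ y, f (x, y) ∂(K x) ≤ M := fun x => by
    have i1 : Integrable (fun y => f (x, y)) (K x) :=
      aux_bdd_s18 _ _ (by fun_prop) M fun y => habs _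
    constructor
    · have := integral_mono (integrable_const δ) i1 (fun y => hl (x, y))
      simpa using this
    · have := integral_mono i1 (integrable_const M) (fun y => hu (x, y))
      simpa using this
  have if0l : Integrable (fun x => (∫ y, f (x, y) ∂(K x)) * Real.log (∫ y, f (x, y) ∂(K x))) μ := by
    refine Integrable.of_bound ?_ L (Eventually.of_forall fun x => hL _ (hf0b x))
    exact Real.continuous_mul_log.comp_aestronglyMeasurable if0.aestronglyMeasurable
  have hloc : ∀ x, (∫ y, f (x, y) * Real.log (f (x, y)) ∂(K x)) -
      (∫ y, f (x, y) ∂(K x)) * Real.log (∫ y, f (x, y) ∂(K x)) ≤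
      Ct / 2 * ∫ y, b (x, y) ^ 2 / f (x, y) ∂(K x) := fun x => by
    have hg : ∀ y, ‖gradient (fun y => f (x, y)) y‖ = b (x, y) := fun y => by
      rw [aux_norm_gradient, (aux_grad2 f hf x y).fderiv]
    have := ha x (fun y => f (x, y)) (fun y => hfpos _) (by fun_prop) (by
      simp_rw [hg]
      exact aux_bdd_s18 _ _ (hB.comp (by fun_prop : Continuous fun y => (x, y))).measurable BB
        fun y => hBB _)
    simp_rw [hg] at this
    exact this
  have hint := integral_mono ((aux_int_compProd μ K _ ifl).sub if0l)
    ((aux_int_compProd μ K _ iB).const_mul (Ct / 2)) hloc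
  simp only [Pi.sub_apply] at hint
  rw [integral_sub (aux_int_compProd μ K _ ifl) if0l, integral_const_mul,
    ← Measure.integral_compProd ifl, ← Measure.integral_compProd iB] at hint
  have iG : Integrable (fun p => (2 * a p ^ 2 + 2 * s ^ 2 * b p ^ 2) / f p) (μ.compProd K) := by
    have := (iA.const_mul 2).add (iB.const_mul (2 * s ^ 2))
    refine this.congr (Eventually.of_forall fun p => ?_)
    simp only [Pi.add_apply]
    ring
  have eG : ∫ p, (2 * a p ^ 2 + 2 * s ^ 2 * b p ^ 2) / f p ∂(μ.compProd K) =
      2 * ∫ p, a p ^ 2 / f p ∂(μ.compProd K) + 2 * s ^ 2 * ∫ p, b p ^ 2 / f p ∂(μ.compProd K) := by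
    rw [← integral_const_mul, ← integral_const_mul,
      ← integral_add (iA.const_mul 2) (iB.const_mul (2 * s ^ 2))]
    congr 1
    ext p
    ring
  have eJ : ∫ p, (a p ^ 2 + b p ^ 2) / f p ∂(μ.compProd K) =
      ∫ p, a p ^ 2 / f p ∂(μ.compProd K) + ∫ p, b p ^ 2 / f p ∂(μ.compProd K) := by
    rw [← integral_add iA iB]
    congr 1
    ext p
    ring
  rw [← Measure.integral_compProd iG, ← Measure.integral_compProd iff', eG] at hmu
  rw [eJ]
  have pA : 0 ≤ ∫ p, a p ^ 2 / f p ∂(μ.compProd K) :=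
    integral_nonneg fun p => div_nonneg (sq_nonneg _) (hfpos p).le
  have pB : 0 ≤ ∫ p, b p ^ 2 / f p ∂(μ.compProd K) :=
    integral_nonneg fun p => div_nonneg (sq_nonneg _) (hfpos p).le
  have m1 := mul_le_mul_of_nonneg_right (le_max_left (2*Cμ) (2*Cμ*s^2 + Ct)) pA
  have m2 := mul_le_mul_of_nonneg_right (le_max_right (2*Cμ) (2*Cμ*s^2 + Ct)) pB
  linarith

theorem aux_tlogt (t : ℝ) (ht : 0 < t) : t ≤ t * Real.log t + 1 := by
  have := mul_le_mul_of_nonneg_left (Real.one_sub_inv_le_log_of_pos ht) ht.le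
  rw [mul_sub, mul_inv_cancel₀ ht.ne'] at this
  linarith

theorem aux_cutoff {d : ℕ} : ∃ (B : ℝ) (θ : ℕ → Euc d × Euc d → ℝ), 0 ≤ B ∧
    (∀ n, ContDiff ℝ 1 (θ n)) ∧ (∀ n, HasCompactSupport (θ n)) ∧
    (∀ n p, 0 ≤ θ n p ∧ θ n p ≤ 1) ∧ (∀ n p, ‖fderiv ℝ (θ n) p‖ ^ 2 ≤ B * θ n p) ∧
    (∀ p, ∀ᶠ n in atTop, θ n =ᶠ[𝓝 p] 1) := by
  let χ : ContDiffBump (0 : Euc d × Euc d) := ⟨1, 2, one_pos, one_lt_two⟩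
  have hχ : ContDiff ℝ 1 χ := χ.contDiff
  obtain ⟨D, hD⟩ := (hχ.continuous_fderiv one_ne_zero).bounded_above_of_compact_support
    (χ.hasCompactSupport.fderiv (𝕜 := ℝ))
  have hD0 : 0 ≤ D := (norm_nonneg _).trans (hD 0)
  have hcp : ∀ n : ℕ, 0 < 1 / ((n : ℝ) + 1) := fun n => by positivity
  have hc1 : ∀ n : ℕ, 1 / ((n : ℝ) + 1) ≤ 1 := fun n => by
    rw [div_le_one (by positivity)]
    linarith [(Nat.cast_nonneg n : (0 : ℝ) ≤ n)]
  refine ⟨4 * D ^ 2, fun n p => χ ((1 / ((n : ℝ) + 1)) • p) ^ 2, by positivity, fun n => ?_,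
    fun n => ?_, fun n p => ⟨sq_nonneg _, ?_⟩, fun n p => ?_, fun p => ?_⟩
  · fun_prop
  · have h1 := χ.hasCompactSupport.comp_smul (hcp n).ne'
    refine h1.mono fun p hp => ?_
    rw [Function.mem_support] at hp ⊢
    intro h0
    apply hp
    simp only
    rw [h0]
    simp
  · exact pow_le_one₀ χ.nonneg χ.le_one
  · have h1 : HasFDerivAt (fun p : Euc d × Euc d => (1 / ((n : ℝ) + 1)) • p)
        ((1 / ((n : ℝ) + 1)) • ContinuousLinearMap.id ℝ (Euc d × Euc d)) p :=
      (hasFDerivAt_id p).const_smul (1 / ((n : ℝ) + 1))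
    have h2 := ((hχ.differentiable one_ne_zero ((1 / ((n : ℝ) + 1)) • p)).hasFDerivAt.comp p h1)
    have h3 := h2.pow 2
    have h4 : fderiv ℝ (fun p => χ ((1 / ((n : ℝ) + 1)) • p) ^ 2) p = _ := h3.fderiv
    rw [h4]
    have h5 : ‖(fderiv ℝ χ ((1 / ((n : ℝ) + 1)) • p)).comp
        ((1 / ((n : ℝ) + 1)) • ContinuousLinearMap.id ℝ (Euc d × Euc d))‖ ≤ D := by
      rw [ContinuousLinearMap.comp_smul, ContinuousLinearMap.comp_id, norm_smul,
        Real.norm_of_nonneg (hcp n).le]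
      calc _ ≤ 1 * D := by
            gcongr
            · exact hc1 n
            · exact hD _
        _ = D := one_mul D
    rw [norm_smul, mul_pow]
    simp only [Function.comp_apply, Nat.add_one_sub_one, pow_one, nsmul_eq_mul, Nat.cast_ofNat,
      Real.norm_eq_abs, sq_abs]
    have h6 := pow_le_pow_left₀ (norm_nonneg _) h5 2
    have h7 := mul_le_mul_of_nonneg_left h6 (sq_nonneg (2 * χ ((1 / ((n : ℝ) + 1)) • p)))
    refine h7.trans (le_of_eq ?_)
    ring
  · have ht : Tendsto (fun n : ℕ => (1 / ((n : ℝ) + 1)) • p) atTop (𝓝 ((0 : ℝ) • p)) :=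
      tendsto_one_div_add_atTop_nhds_zero_nat.smul_const p
    rw [zero_smul] at ht
    filter_upwards [ht.eventually (Metric.ball_mem_nhds 0 one_pos)] with n hn
    have hcont : Continuous (fun p : Euc d × Euc d => (1 / ((n : ℝ) + 1)) • p) := by fun_prop
    filter_upwards [(hcont.tendsto p).eventually
      (χ.eventuallyEq_one_of_mem_ball (x := (1 / ((n : ℝ) + 1)) • p) hn)] with q hq
    rw [hq]
    simp

theorem aux_general {d : ℕ} (ρ : Measure (Euc d × Euc d)) [IsProbabilityMeasure ρ] (C : ℝ)
    (hC : 0 ≤ C)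
    (N : ∀ (f : Euc d × Euc d → ℝ) (_ : ContDiff ℝ 1 f) (δ M : ℝ) (_ : 0 < δ)
      (_ : ∀ p, δ ≤ f p) (_ : ∀ p, f p ≤ M)
      (_ : ∀ p, ‖fderiv ℝ f p‖ ≤ M) (_ : HasCompactSupport (fderiv ℝ f)),
      (∫ p, f p * Real.log (f p) ∂ρ) - (∫ p, f p ∂ρ) * Real.log (∫ p, f p ∂ρ) ≤
      C / 2 * ∫ p, (‖(fderiv ℝ f p).comp
        (ContinuousLinearMap.inl ℝ (Euc d) (Euc d))‖ ^ 2 +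
        ‖(fderiv ℝ f p).comp
          (ContinuousLinearMap.inr ℝ (Euc d) (Euc d))‖ ^ 2) / f p ∂ρ) :
    HasLSI2 ρ C := by
  intro f hfpos hf hJ
  have hg1 : ∀ p : Euc d × Euc d, ‖gradient (fun x => f (x, p.2)) p.1‖ = ‖(fderiv ℝ f p).comp
      (ContinuousLinearMap.inl ℝ (Euc d) (Euc d))‖ := fun p => by
    rw [aux_norm_gradient, (aux_grad1 f hf p.1 p.2).fderiv]
  have hg2 : ∀ p : Euc d × Euc d, ‖gradient (fun y => f (p.1, y)) p.2‖ = ‖(fderiv ℝ f p).comp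
      (ContinuousLinearMap.inr ℝ (Euc d) (Euc d))‖ := fun p => by
    rw [aux_norm_gradient, (aux_grad2 f hf p.1 p.2).fderiv]
  simp_rw [hg1, hg2] at hJ ⊢
  clear hg1 hg2
  have hfc := hf.continuous
  have hfd : Continuous (fderiv ℝ f) := hf.continuous_fderiv one_ne_zero
  set J : (Euc d × Euc d → ℝ) → Euc d × Euc d → ℝ := fun f p => (‖(fderiv ℝ f p).comp
        (ContinuousLinearMap.inl ℝ (Euc d) (Euc d))‖ ^ 2 +
        ‖(fderiv ℝ f p).comp
          (ContinuousLinearMap.inr ℝ (Euc d) (Euc d))‖ ^ 2) / f p with hJdef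
  change Integrable (J f) ρ at hJ
  change _ ≤ C / 2 * ∫ p, J f p ∂ρ
  have hflm : Continuous (fun p => f p * Real.log (f p)) := Real.continuous_mul_log.comp hfc
  have hflog : Integrable (fun p => f p * Real.log (f p)) ρ → Integrable f ρ := fun h => by
    refine (h.add (integrable_const 1)).mono' hfc.aestronglyMeasurable
      (Eventually.of_forall fun p => ?_)
    rw [Real.norm_of_nonneg (hfpos p).le]
    exact aux_tlogt _ (hfpos p)
  by_cases hfi : Integrable f ρ
  swap
  · rw [integral_undef hfi, integral_undef (fun h => hfi (hflog h))]
    have : 0 ≤ ∫ p, J f p ∂ρ := integral_nonneg fun p => div_nonneg (by positivity) (hfpos p).le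
    have := mul_nonneg (div_nonneg hC zero_le_two) this
    simpa using this
  obtain ⟨B, θ, hB0, hθ1, hθs, hθb, hθd, hθt⟩ := aux_cutoff (d := d)
  have hcp : ∀ n : ℕ, 0 < 1 / ((n : ℝ) + 1) := fun n => by positivity
  have hc1 : ∀ n : ℕ, 1 / ((n : ℝ) + 1) ≤ 1 := fun n => by
    rw [div_le_one (by positivity)]
    linarith [(Nat.cast_nonneg n : (0 : ℝ) ≤ n)]
  have hct : Tendsto (fun n : ℕ => 1 / ((n : ℝ) + 1)) atTop (𝓝 0) :=
    tendsto_one_div_add_atTop_nhds_zero_nat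
  set g : ℕ → Euc d × Euc d → ℝ := fun n p => 1 / ((n : ℝ) + 1) + θ n p * f p with hg
  have hg1 : ∀ n, ContDiff ℝ 1 (g n) := fun n => contDiff_const.add ((hθ1 n).mul hf)
  have hgl : ∀ (n : ℕ) p, 1 / ((n : ℝ) + 1) ≤ g n p := fun n p =>
    le_add_of_nonneg_right (mul_nonneg (hθb n p).1 (hfpos p).le)
  have hgpos : ∀ n p, 0 < g n p := fun n p => (hcp n).trans_le (hgl n p)
  have hgu : ∀ n p, g n p ≤ 1 + f p := fun n p =>
    add_le_add (hc1 n) (mul_le_of_le_one_left (hfpos p).le (hθb n p).2)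
  have hgd : ∀ n p, fderiv ℝ (g n) p = θ n p • fderiv ℝ f p + f p • fderiv ℝ (θ n) p := fun n p => by
    have h1 := (((hθ1 n).differentiable one_ne_zero p).hasFDerivAt.mul
      (hf.differentiable one_ne_zero p).hasFDerivAt).const_add (1 / ((n : ℝ) + 1))
    exact h1.fderiv
  have hthf : ∀ n, HasCompactSupport (fun p => θ n p * f p) := fun n => (hθs n).mul_right
  have hgs : ∀ n, HasCompactSupport (fderiv ℝ (g n)) := fun n => by
    have : fderiv ℝ (g n) = fderiv ℝ (fun p => θ n p * f p) := by
      ext1 p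
      exact fderiv_const_add _
    rw [this]
    exact (hthf n).fderiv (𝕜 := ℝ)
  -- nice LSI
  have main : ∀ n, (∫ p, g n p * Real.log (g n p) ∂ρ) - (∫ p, g n p ∂ρ) * Real.log (∫ p, g n p ∂ρ) ≤
      C / 2 * ∫ p, J (g n) p ∂ρ := fun n => by
    obtain ⟨M1, hM1⟩ := ((hθ1 n).mul hf).continuous.bounded_above_of_compact_support (hthf n)
    obtain ⟨M2, hM2⟩ :=
      ((hg1 n).continuous_fderiv one_ne_zero).bounded_above_of_compact_support (hgs n)
    refine N (g n) (hg1 n) _ (max (1 + M1) M2) (hcp n) (hgl n) (fun p => ?_) (fun p => ?_) (hgs n)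
    · exact (add_le_add (hc1 n) ((le_abs_self _).trans (hM1 p))).trans (le_max_left _ _)
    · exact (hM2 p).trans (le_max_right _ _)
  have igl : ∀ n, Integrable (fun p => g n p * Real.log (g n p)) ρ := fun n => by
    obtain ⟨M1, hM1⟩ := ((hθ1 n).mul hf).continuous.bounded_above_of_compact_support (hthf n)
    obtain ⟨L, hL⟩ := (isCompact_Icc (a := 1 / ((n : ℝ) + 1))
      (b := 1 + M1)).exists_bound_of_continuousOn Real.continuous_mul_log.continuousOn
    exact aux_bdd_s18 _ _ (Real.continuous_mul_log.comp (hg1 n).continuous).measurable L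
      fun p => hL _ ⟨hgl n p, add_le_add (hc1 n) ((le_abs_self _).trans (hM1 p))⟩
  -- pointwise limits
  have hgt : ∀ p, Tendsto (fun n => g n p) atTop (𝓝 (f p)) := fun p => by
    have h1 : Tendsto (fun n : ℕ => 1 / ((n : ℝ) + 1) + f p) atTop (𝓝 (0 + f p)) :=
      hct.add_const (f p)
    rw [zero_add] at h1
    refine h1.congr' ?_
    filter_upwards [hθt p] with n hn
    have : θ n p = 1 := hn.self_of_nhds
    simp [hg, this]
  have hJt : ∀ p, Tendsto (fun n => J (g n) p) atTop (𝓝 (J f p)) := fun p => by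
    have h1 : Tendsto (fun n : ℕ => (‖(fderiv ℝ f p).comp
        (ContinuousLinearMap.inl ℝ (Euc d) (Euc d))‖ ^ 2 +
        ‖(fderiv ℝ f p).comp
          (ContinuousLinearMap.inr ℝ (Euc d) (Euc d))‖ ^ 2) / g n p) atTop (𝓝 (J f p)) :=
      tendsto_const_nhds.div (hgt p) (hfpos p).ne'
    refine h1.congr' ?_
    filter_upwards [hθt p] with n hn
    have e1 : θ n p = 1 := hn.self_of_nhds
    have e2 : fderiv ℝ (θ n) p = 0 := by
      rw [hn.fderiv_eq]
      exact fderiv_const_apply (1 : ℝ)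
    simp only [hJdef, hgd, e1, e2, one_smul, smul_zero, add_zero]
  -- domination
  have sq1 : ∀ n p (I : Euc d →L[ℝ] Euc d × Euc d), ‖I‖ ≤ 1 →
      ‖(fderiv ℝ (g n) p).comp I‖ ^ 2 / g n p ≤
        2 * (‖(fderiv ℝ f p).comp I‖ ^ 2 / f p) + 2 * B * f p := fun n p I hI => by
    have hfp := hfpos p
    have ht := (hθb n p).1
    have ht1 := (hθb n p).2
    have h1 : ‖(fderiv ℝ (g n) p).comp I‖ ≤
        θ n p * ‖(fderiv ℝ f p).comp I‖ + f p * ‖fderiv ℝ (θ n) p‖ := by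
      rw [hgd, ContinuousLinearMap.add_comp, ContinuousLinearMap.smul_comp,
        ContinuousLinearMap.smul_comp]
      refine (norm_add_le _ _).trans ?_
      rw [norm_smul, norm_smul, Real.norm_of_nonneg ht, Real.norm_of_nonneg hfp.le]
      gcongr
      refine (ContinuousLinearMap.opNorm_comp_le _ _).trans ?_
      exact mul_le_of_le_one_right (norm_nonneg _) hI
    rw [div_le_iff₀ (hgpos n p)]
    set A := ‖(fderiv ℝ f p).comp I‖ with hA
    set D := ‖fderiv ℝ (θ n) p‖ with hD
    have hA0 : 0 ≤ A := norm_nonneg _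
    have hDD : D ^ 2 ≤ B * θ n p := hθd n p
    have h2 := pow_le_pow_left₀ (norm_nonneg _) h1 2
    have h3 : (θ n p * A + f p * D) ^ 2 ≤ 2 * (θ n p ^ 2 * A ^ 2) + 2 * (f p ^ 2 * D ^ 2) := by
      nlinarith [sq_nonneg (θ n p * A - f p * D)]
    have h4 : f p ^ 2 * D ^ 2 ≤ f p ^ 2 * (B * θ n p) := by gcongr
    have h5 : θ n p ^ 2 * A ^ 2 ≤ θ n p * A ^ 2 := by
      gcongr
      nlinarith
    have h6 : (2 * (A ^ 2 / f p) + 2 * B * f p) * (θ n p * f p) =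
        2 * (θ n p * A ^ 2) + 2 * (f p ^ 2 * (B * θ n p)) := by
      field_simp
    have h7 : (2 * (A ^ 2 / f p) + 2 * B * f p) * (θ n p * f p) ≤
        (2 * (A ^ 2 / f p) + 2 * B * f p) * g n p := by
      apply mul_le_mul_of_nonneg_left _ (by positivity)
      simp only [hg]
      linarith [hcp n]
    linarith
  have hJb : ∀ n p, J (g n) p ≤ 2 * J f p + 4 * B * f p := fun n p => by
    have h1 := sq1 n p _ (ContinuousLinearMap.norm_inl_le_one ℝ (Euc d) (Euc d))
    have h2 := sq1 n p _ (ContinuousLinearMap.norm_inr_le_one ℝ (Euc d) (Euc d))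
    simp only [hJdef, add_div]
    linarith
  have tJ : Tendsto (fun n => ∫ p, J (g n) p ∂ρ) atTop (𝓝 (∫ p, J f p ∂ρ)) := by
    refine tendsto_integral_of_dominated_convergence (fun p => 2 * J f p + 4 * B * f p)
      (fun n => ?_) ((hJ.const_mul 2).add (hfi.const_mul (4 * B)))
      (fun n => Eventually.of_forall fun p => ?_) (Eventually.of_forall hJt)
    · have hgdc := (hg1 n).continuous_fderiv one_ne_zero
      refine Continuous.aestronglyMeasurable ?_
      simp only [hJdef]
      exact Continuous.div (by fun_prop) (hg1 n).continuous (fun p => (hgpos n p).ne')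
    · rw [Real.norm_of_nonneg (div_nonneg (by positivity) (hgpos n p).le)]
      exact hJb n p
  have tg : Tendsto (fun n => ∫ p, g n p ∂ρ) atTop (𝓝 (∫ p, f p ∂ρ)) := by
    refine tendsto_integral_of_dominated_convergence (fun p => 1 + f p)
      (fun n => (hg1 n).continuous.aestronglyMeasurable) ((integrable_const 1).add hfi)
      (fun n => Eventually.of_forall fun p => ?_) (Eventually.of_forall hgt)
    rw [Real.norm_of_nonneg (hgpos n p).le]
    exact hgu n p
  set R : ℕ → ℝ := fun n => C / 2 * ∫ p, J (g n) p ∂ρ +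
    (∫ p, g n p ∂ρ) * Real.log (∫ p, g n p ∂ρ) + 1 with hR
  set R' : ℝ := C / 2 * ∫ p, J f p ∂ρ + (∫ p, f p ∂ρ) * Real.log (∫ p, f p ∂ρ) + 1 with hR'
  have tR : Tendsto R atTop (𝓝 R') :=
    ((tJ.const_mul _).add ((Real.continuous_mul_log.tendsto _).comp tg)).add_const 1
  have hnn : ∀ t : ℝ, 0 < t → 0 ≤ t * Real.log t + 1 := fun t ht => ht.le.trans (aux_tlogt t ht)
  have fatou : ∫⁻ p, ENNReal.ofReal (f p * Real.log (f p) + 1) ∂ρ ≤ ENNReal.ofReal R' := by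
    have e1 : ∀ p, ENNReal.ofReal (f p * Real.log (f p) + 1) =
        liminf (fun n => ENNReal.ofReal (g n p * Real.log (g n p) + 1)) atTop := fun p => by
      refine (Tendsto.liminf_eq ?_).symm
      refine (ENNReal.continuous_ofReal.tendsto _).comp ?_
      exact ((Real.continuous_mul_log.tendsto _).comp (hgt p)).add_const 1
    simp_rw [e1]
    refine (lintegral_liminf_le fun n => ?_).trans ?_
    · exact (ENNReal.continuous_ofReal.comp
        ((Real.continuous_mul_log.comp (hg1 n).continuous).add continuous_const)).measurable
    · have hle : ∀ n, ∫⁻ p, ENNReal.ofReal (g n p * Real.log (g n p) + 1) ∂ρ ≤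
          ENNReal.ofReal (R n) := fun n => by
        have igl1 : Integrable (fun p => g n p * Real.log (g n p) + 1) ρ :=
          (igl n).add (integrable_const 1)
        rw [← ofReal_integral_eq_lintegral_ofReal igl1
          (Eventually.of_forall fun p => hnn _ (hgpos n p))]
        apply ENNReal.ofReal_le_ofReal
        rw [integral_add (igl n) (integrable_const 1)]
        have := main n
        simp only [integral_const, probReal_univ, one_smul, hR]
        linarith
      have tt := (ENNReal.continuous_ofReal.tendsto _).comp tR
      calc _ ≤ liminf (fun n => ENNReal.ofReal (R n)) atTop :=
            liminf_le_liminf (Eventually.of_forall hle)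
        _ = ENNReal.ofReal R' := tt.liminf_eq
  have hifl1 : Integrable (fun p => f p * Real.log (f p) + 1) ρ := by
    refine ⟨(hflm.add continuous_const).aestronglyMeasurable, ?_⟩
    rw [hasFiniteIntegral_iff_ofReal (Eventually.of_forall fun p => hnn _ (hfpos p))]
    exact fatou.trans_lt ENNReal.ofReal_lt_top
  have hifl : Integrable (fun p => f p * Real.log (f p)) ρ := by
    have := hifl1.sub (integrable_const 1)
    refine this.congr (Eventually.of_forall fun p => ?_)
    simp
  have hR0 : 0 ≤ R' := by
    refine ge_of_tendsto' tR fun n => ?_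
    have h0 : 0 ≤ ∫ p, (g n p * Real.log (g n p) + 1) ∂ρ :=
      integral_nonneg fun p => hnn _ (hgpos n p)
    rw [integral_add (igl n) (integrable_const 1)] at h0
    simp only [integral_const, probReal_univ, one_smul] at h0
    have := main n
    simp only [hR]
    linarith
  rw [← ofReal_integral_eq_lintegral_ofReal hifl1
    (Eventually.of_forall fun p => hnn _ (hfpos p)), ENNReal.ofReal_le_ofReal_iff hR0,
    integral_add hifl (integrable_const 1)] at fatou
  simp only [integral_const, probReal_univ, one_smul, hR'] at fatou
  linarith

theorem aux_Cnonneg {d : ℕ} (hd : 0 < d) (μ : Measure (Euc d)) [IsProbabilityMeasure μ] (C : ℝ)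
    (hμ : HasLSI μ C) : 0 ≤ C := by
  by_contra hC
  push Not at hC
  let i : Fin d := ⟨0, hd⟩
  set P : Euc d →L[ℝ] ℝ := EuclideanSpace.proj i with hP
  have hP0 : P ≠ 0 := fun h => by
    have := congrArg (fun L : Euc d →L[ℝ] ℝ => L (EuclideanSpace.single i 1)) h
    simp [hP] at this
  set f : Euc d → ℝ := fun x => 2 + Real.arctan (P x) with hf
  have hpi := Real.pi_lt_four
  have hpi2 := Real.pi_pos
  have hlo : ∀ x, 0 < f x := fun x => by
    have := Real.neg_pi_div_two_lt_arctan (P x)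
    simp only [hf]
    linarith
  have hhi : ∀ x, f x ≤ 4 := fun x => by
    have := Real.arctan_lt_pi_div_two (P x)
    simp only [hf]
    linarith
  have hf1 : ContDiff ℝ 1 f := contDiff_const.add (Real.contDiff_arctan.comp P.contDiff)
  have hder : ∀ x, fderiv ℝ f x = (1 / (1 + (P x) ^ 2)) • P := fun x =>
    (((Real.hasDerivAt_arctan (P x)).comp_hasFDerivAt x P.hasFDerivAt).const_add 2).fderiv
  have hn : ∀ x, ‖gradient f x‖ = 1 / (1 + (P x) ^ 2) * ‖P‖ := fun x => by
    rw [aux_norm_gradient, hder, norm_smul, Real.norm_of_nonneg (by positivity)]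
  have hPn : 0 < ‖P‖ := norm_pos_iff.2 hP0
  have hpos : ∀ x, 0 < ‖gradient f x‖ ^ 2 / f x := fun x => by
    rw [hn]
    have := hlo x
    positivity
  have hlo2 : ∀ x, 2 - π / 2 ≤ f x := fun x => by
    have := Real.neg_pi_div_two_lt_arctan (P x)
    simp only [hf]
    linarith
  have hq : 0 < 2 - π / 2 := by linarith
  have hgi : Integrable (fun x => ‖gradient f x‖ ^ 2 / f x) μ := by
    have hgc : Continuous (fun x => ‖gradient f x‖ ^ 2 / f x) := by
      simp_rw [aux_norm_gradient]
      exact ((hf1.continuous_fderiv one_ne_zero).norm.pow 2).div hf1.continuous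
        (fun x => (hlo x).ne')
    refine aux_bdd_s18 _ _ hgc.measurable (‖P‖ ^ 2 / (2 - π / 2)) fun x => ?_
    rw [abs_of_pos (hpos x), hn]
    have h1 : 1 / (1 + (P x) ^ 2) ≤ 1 := by
      rw [div_le_one (by positivity)]
      nlinarith [sq_nonneg (P x)]
    have h2 : 1 / (1 + (P x) ^ 2) * ‖P‖ ≤ ‖P‖ := mul_le_of_le_one_left hPn.le h1
    have h3 := hlo2 x
    gcongr
  have key := hμ f hlo hf1 hgi
  have hIpos : 0 < ∫ x, ‖gradient f x‖ ^ 2 / f x ∂μ := by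
    rw [integral_pos_iff_support_of_nonneg (fun x => (hpos x).le) hgi]
    have : Function.support (fun x => ‖gradient f x‖ ^ 2 / f x) = Set.univ := by
      ext x
      simpa using (hpos x).ne'
    rw [this]
    simp
  have ifi : Integrable f μ := aux_bdd_s18 _ _ hf1.continuous.measurable 4 fun x => by
    rw [abs_of_pos (hlo x)]; exact hhi x
  obtain ⟨L, hL⟩ := (isCompact_Icc (a := (0 : ℝ)) (b := 4)).exists_bound_of_continuousOn
    Real.continuous_mul_log.continuousOn
  have ifl : Integrable (fun x => f x * Real.log (f x)) μ :=
    aux_bdd_s18 _ _ (Real.continuous_mul_log.comp hf1.continuous).measurable L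
      fun p => hL _ ⟨(hlo p).le, hhi p⟩
  have hjen : (∫ x, f x ∂μ) * Real.log (∫ x, f x ∂μ) ≤ ∫ x, f x * Real.log (f x) ∂μ := by
    have := Real.convexOn_mul_log.map_integral_le (μ := μ) (f := f)
      Real.continuous_mul_log.continuousOn isClosed_Ici
      (Eventually.of_forall fun x => (hlo x).le) ifi ifl
    exact this
  have := mul_neg_of_neg_of_pos (by linarith : C / 2 < 0) hIpos
  linarith

end fin

end aux

/-- mixing lemma: if `μ` satisfies LSI(C_μ) and the Markov
kernel `K` satisfies local LSIs with constant `C̃` and a squared gradient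
estimate with constant `C₀` (together with the chain rule decomposition of the
gradient), then `π = μ ⊗ K` satisfies LSI with constant
`max{2C_μ, 2C_μC₀ + C̃}`. -/
theorem stmt18 {d : ℕ} (Cμ Ct C0 : ℝ) (hCt : 0 ≤ Ct) (hC0 : 0 ≤ C0)
    (μ : Measure (Euc d)) [IsProbabilityMeasure μ]
    (hμ : HasLSI μ Cμ)
    (K : ProbabilityTheory.Kernel (Euc d) (Euc d))
    [ProbabilityTheory.IsMarkovKernel K]
    -- (a) local (conditional) logarithmic Sobolev inequalities
    (ha : ∀ (x : Euc d) (g : Euc d → ℝ), (∀ y, 0 < g y) → ContDiff ℝ 1 g →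
      Integrable (fun y => ‖gradient g y‖^2 / g y) (K x) →
      (∫ y, g y * Real.log (g y) ∂(K x)) -
          (∫ y, g y ∂(K x)) * Real.log (∫ y, g y ∂(K x)) ≤
        Ct/2 * ∫ y, ‖gradient g y‖^2 / g y ∂(K x))
    -- (b) gradient estimate
    (hb : ∀ g : Euc d → ℝ, ContDiff ℝ 1 g → (∃ M : ℝ, ∀ y, ‖gradient g y‖ ≤ M) →
      Differentiable ℝ (fun x => ∫ y, g y ∂(K x)) ∧
      ∀ x : Euc d, ‖gradient (fun x' => ∫ y, g y ∂(K x')) x‖^2 ≤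
        C0 * (∫ y, ‖gradient g y‖ ∂(K x))^2)
    -- (c) chain rule decomposition of the gradient of `x ↦ ∫ f(x, y) K(x)(dy)`
    (hc : ∀ f : Euc d × Euc d → ℝ, (∀ p, 0 < f p) → ContDiff ℝ 1 f →
      Differentiable ℝ (fun x => ∫ y, f (x, y) ∂(K x)) ∧
      ∀ x : Euc d, gradient (fun x' => ∫ y, f (x', y) ∂(K x')) x =
        (∫ y, gradient (fun x' => f (x', y)) x ∂(K x)) +
          gradient (fun z => ∫ y, f (x, y) ∂(K z)) x) :
    HasLSI2 (μ.compProd K) (max (2*Cμ) (2*Cμ*C0 + Ct)) := by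
  have hs : Real.sqrt C0 ^ 2 = C0 := Real.sq_sqrt hC0
  have hb' : ∀ g : Euc d → ℝ, ContDiff ℝ 1 g → (∃ M : ℝ, ∀ y, ‖fderiv ℝ g y‖ ≤ M) →
      Differentiable ℝ (fun x => ∫ y, g y ∂(K x)) ∧
      ∀ x : Euc d, ‖fderiv ℝ (fun x' => ∫ y, g y ∂(K x')) x‖ ≤
        Real.sqrt C0 * ∫ y, ‖fderiv ℝ g y‖ ∂(K x) := by
    intro g hg hM
    have h := hb g hg (by simpa only [aux_norm_gradient] using hM)
    refine ⟨h.1, fun x => ?_⟩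
    have h2 := h.2 x
    simp only [aux_norm_gradient] at h2
    have h3 : 0 ≤ ∫ y, ‖fderiv ℝ g y‖ ∂(K x) := integral_nonneg fun y => norm_nonneg _
    refine abs_le_of_sq_le_sq' ?_ (mul_nonneg (Real.sqrt_nonneg _) h3) |>.2
    rw [mul_pow, hs]
    exact h2
  have main : ∀ C : ℝ, 0 ≤ C → HasLSI μ C →
      HasLSI2 (μ.compProd K) (max (2*C) (2*C*C0 + Ct)) := by
    intro C hC hL
    refine aux_general _ _ (le_max_of_le_left (by positivity)) ?_
    intro f hf δ M hδ hl hu hM' hsupp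
    have := aux_core_pi K μ C Ct hC hL (Real.sqrt C0) (Real.sqrt_nonneg _) ha hb' f hf δ M hδ
      hl hu hM' hsupp
    rw [hs] at this
    exact this
  rcases Nat.eq_zero_or_pos d with hd | hd
  · subst hd
    have hz : ∀ (g : Euc 0 → ℝ) (x : Euc 0), gradient g x = 0 := fun g x => Subsingleton.elim _ _
    have h0 : HasLSI μ 0 := by
      intro f h1 h2 h3
      have := hμ f h1 h2 h3
      simp only [hz, norm_zero, ne_eq, OfNat.ofNat_ne_zero, not_false_eq_true, zero_pow, zero_div,
        integral_zero, mul_zero] at this ⊢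
      exact this
    intro f h1 h2 h3
    have := main 0 le_rfl h0 f h1 h2 h3
    simp only [hz, norm_zero, ne_eq, OfNat.ofNat_ne_zero, not_false_eq_true, zero_pow, zero_div,
      integral_zero, mul_zero, add_zero] at this ⊢
    exact this
  · exact main Cμ (aux_Cnonneg hd μ Cμ hμ) hμ

end
end
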